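/- arXiv:2509.19148 — 4 statements merged into one kernel-verified Lean document; each statement's English description precedes it below -/
import Mathlib

section
/- Let (A,D) be a pseudo-Cartan inclusion with Cartan envelope (A₁, D₁, α). Then the map J ↦ ((α(J ∩ D))^{⊥⊥_{D₁}})^{⊥⊥_{A₁}} (first the double annihilator in D₁, then the double annihilator in A₁) is an inclusion-preserving bijection from the set of regular ideals of A onto the set of regular ideals of A₁. -/
section Defs

variable {A : Type*} [NonUnitalCStarAlgebra A] [PartialOrder A] [StarOrderedRing A]

/-- `n` is a normalizer of `B` in `A`: `n B n* ⊆ B` and `n* B n ⊆ B`. -/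
def IsNormalizer (B : Set A) (n : A) : Prop :=
  (∀ b ∈ B, n * b * star n ∈ B) ∧ (∀ b ∈ B, star n * b * n ∈ B)

/-- `(A, B)` is an inclusion of C*-algebras: `B` is a closed *-subalgebra of `A`
containing an approximate unit for `A`. -/
structure IsInclusion (B : Set A) : Prop where
  zero_mem : (0 : A) ∈ B
  add_mem : ∀ x ∈ B, ∀ y ∈ B, x + y ∈ B
  smul_mem : ∀ (c : ℂ), ∀ x ∈ B, c • x ∈ B
  mul_mem : ∀ x ∈ B, ∀ y ∈ B, x * y ∈ B
  star_mem : ∀ x ∈ B, star x ∈ B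
  isClosed : IsClosed B
  approxUnit : ∀ (s : Finset A), ∀ ε : ℝ, 0 < ε →
    ∃ e ∈ B, 0 ≤ e ∧ ‖e‖ ≤ 1 ∧ ∀ a ∈ s, ‖e * a - a‖ < ε

/-- A regular inclusion: an inclusion whose normalizers span a dense subspace of `A`. -/
def IsRegularInclusion (B : Set A) : Prop :=
  IsInclusion B ∧ Dense (↑(Submodule.span ℂ {n : A | IsNormalizer B n}) : Set A)

/-- `J` is a closed two-sided ideal of the C*-subalgebra `C`. -/
structure IsClosedIdealOf (C J : Set A) : Prop where
  subset : J ⊆ C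
  zero_mem : (0 : A) ∈ J
  add_mem : ∀ x ∈ J, ∀ y ∈ J, x + y ∈ J
  smul_mem : ∀ (c : ℂ), ∀ x ∈ J, c • x ∈ J
  mul_left : ∀ c ∈ C, ∀ x ∈ J, c * x ∈ J
  mul_right : ∀ x ∈ J, ∀ c ∈ C, x * c ∈ J
  isClosed : IsClosed J

/-- The annihilator `X^{⊥}` of `X`, computed inside `C`. -/
def Ann (C X : Set A) : Set A :=
  {c ∈ C | ∀ x ∈ X, c * x = 0 ∧ x * c = 0}

/-- `J` is a regular ideal of `C`: a closed two-sided ideal with `J = J^{⊥⊥}` in `C`. -/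
def IsRegularIdealOf (C J : Set A) : Prop :=
  IsClosedIdealOf C J ∧ Ann C (Ann C J) = J

/-- The inclusion `(C, B)` has the ideal intersection property: every nonzero closed
two-sided ideal of `C` meets `B` nontrivially. -/
def IdealIntersectionProperty (C B : Set A) : Prop :=
  ∀ J : Set A, IsClosedIdealOf C J → (∃ x ∈ J, x ≠ 0) → ∃ x ∈ J ∩ B, x ≠ 0

/-- The relative commutant of `D` in `A`. -/
def RelComm (D : Set A) : Set A := {a : A | ∀ d ∈ D, a * d = d * a}

/-- `(A, D)` is a pseudo-Cartan inclusion. -/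
structure IsPseudoCartan (D : Set A) : Prop where
  inclusion : IsInclusion D
  regular : Dense (↑(Submodule.span ℂ {n : A | IsNormalizer D n}) : Set A)
  abelian : ∀ x ∈ D, ∀ y ∈ D, x * y = y * x
  relCommAbelian : ∀ x ∈ RelComm D, ∀ y ∈ RelComm D, x * y = y * x
  iip_relComm : IdealIntersectionProperty (RelComm D) D
  iip_A : IdealIntersectionProperty (Set.univ : Set A) (RelComm D)

/-- `K` is an invariant ideal of `D`: `n K n* ⊆ K` for every normalizer `n`. -/
def IsInvariantIdeal (D K : Set A) : Prop :=
  ∀ n : A, IsNormalizer D n → ∀ x ∈ K, n * x * star n ∈ K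

/-- `K` is an invariant regular ideal of `D`. -/
def IsInvariantRegularIdeal (D K : Set A) : Prop :=
  IsRegularIdealOf D K ∧ IsInvariantIdeal D K

/-- The image set `x B y = {x * b * y : b ∈ B}`. -/
def twoSidedImage (x y : A) (B : Set A) : Set A := (fun b => x * b * y) '' B

end Defs

section Cartan

variable {A : Type*} [NonUnitalCStarAlgebra A] [PartialOrder A] [StarOrderedRing A]
variable {A₁ : Type*} [NonUnitalCStarAlgebra A₁] [PartialOrder A₁] [StarOrderedRing A₁]

/-- `E` is a faithful conditional expectation of `A₁` onto `D₁`. -/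
structure IsCondExp (D₁ : Set A₁) (E : A₁ → A₁) : Prop where
  map_add : ∀ x y : A₁, E (x + y) = E x + E y
  map_smul : ∀ (c : ℂ) (x : A₁), E (c • x) = c • E x
  mem : ∀ a : A₁, E a ∈ D₁
  fixes : ∀ d ∈ D₁, E d = d
  bimodule : ∀ d ∈ D₁, ∀ a : A₁, ∀ d' ∈ D₁, E (d * a * d') = d * E a * d'
  positive : ∀ a : A₁, 0 ≤ a → 0 ≤ E a
  faithful : ∀ a : A₁, E (star a * a) = 0 → a = 0

/-- `(A₁, D₁)` is a Cartan inclusion with faithful conditional expectation `E`: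
a regular inclusion with `D₁` maximal abelian admitting a faithful conditional
expectation onto `D₁`. -/
structure IsCartanInclusion (D₁ : Set A₁) (E : A₁ → A₁) : Prop where
  regularInclusion : IsRegularInclusion D₁
  abelian : ∀ x ∈ D₁, ∀ y ∈ D₁, x * y = y * x
  maximalAbelian : ∀ a : A₁, (∀ d ∈ D₁, a * d = d * a) → a ∈ D₁
  condExp : IsCondExp D₁ E

/-- The C*-subalgebra generated by a subset `S`. -/
def GeneratedCStar (S : Set A₁) : Set A₁ :=
  closure (NonUnitalStarAlgebra.adjoin ℂ S : Set A₁)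

/-- `(A₁, D₁, α)`, with faithful conditional expectation `E : A₁ → D₁`, is a Cartan
envelope of `(A, D)`. -/
structure IsCartanEnvelope (D : Set A) (D₁ : Set A₁) (α : A →⋆ₙₐ[ℂ] A₁) (E : A₁ → A₁) :
    Prop where
  cartan : IsCartanInclusion D₁ E
  injective : Function.Injective α
  maps : ∀ d ∈ D, α d ∈ D₁
  regular_morphism : ∀ n : A, IsNormalizer D n → IsNormalizer D₁ (α n)
  generates : GeneratedCStar (Set.range ⇑α ∪ E '' Set.range ⇑α) = (Set.univ : Set A₁)
  generatesD : D₁ = GeneratedCStar (E '' Set.range ⇑α)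
  iip : IdealIntersectionProperty D₁ (⇑α '' D)

end Cartan


section CommPart

open WeakDual Unitization

/-- A commutative C*-algebra embeds as an ideal of some `C(X, ℂ)`, `X` compact. -/
theorem rie_package (B : Type*) [NonUnitalCommCStarAlgebra B] :
    ∃ (f : B →⋆ₙₐ[ℂ] C(characterSpace ℂ (Unitization ℂ B), ℂ)), (∀ b, ‖f b‖ = ‖b‖) ∧
      ∀ (φ : C(characterSpace ℂ (Unitization ℂ B), ℂ)) (b : B), ∃ b', f b' = φ * f b := by
  let g := gelfandStarTransform (Unitization ℂ B)
  refine ⟨(NonUnitalStarAlgHomClass.toNonUnitalStarAlgHom g).comp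
    (inrNonUnitalStarAlgHom ℂ B), ?_, ?_⟩
  · intro b
    have h1 : Isometry g := gelfandTransform_isometry _
    have h2 : ‖g (b : Unitization ℂ B)‖ = ‖(b : Unitization ℂ B)‖ :=
      h1.norm_map_of_map_zero (map_zero g) _
    have h3 : ‖(b : Unitization ℂ B)‖ = ‖b‖ := 
      (isometry_inr (𝕜 := ℂ) (A := B)).norm_map_of_map_zero (by simp) _
    exact h2.trans h3
  · intro φ b
    obtain ⟨u, rfl⟩ := g.surjective φ
    refine ⟨u.fst • b + u.snd * b, ?_⟩
    change g ((u.fst • b + u.snd * b : B) : Unitization ℂ B) = g u * g (b : Unitization ℂ B)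
    rw [← map_mul]
    congr 1
    ext <;> simp

/-- Cut-offs in a commutative C*-algebra. -/
theorem rie_bump {B : Type*} [NonUnitalCommCStarAlgebra B] (h : B) (hh : h ≠ 0) :
    ∃ r : ℝ, 0 < r ∧ ∃ g k y : B, g ≠ 0 ∧ ‖k‖ * r ≤ 1 ∧ ‖k * h‖ ≤ 1 ∧ k * h * g = g ∧
      g = h * y := by
  obtain ⟨f, hf, hi⟩ := rie_package B
  have inj : ∀ a b, f a = f b → a = b := by
    intro a b hab
    have : ‖f (a - b)‖ = 0 := by rw [map_sub, hab, sub_self, norm_zero]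
    rw [hf, norm_eq_zero, sub_eq_zero] at this
    exact this
  have h0 : f h ≠ 0 := fun hc => hh (inj _ _ (by rw [hc, map_zero]))
  obtain ⟨x0, hx0⟩ : ∃ x, f h x ≠ 0 := by
    by_contra! hc
    exact h0 (ContinuousMap.ext hc)
  set r : ℝ := ‖f h x0‖ / 2 with hr
  have hrpos : 0 < r := by positivity
  have hm : ∀ x, 0 < max ‖f h x‖ r := fun x => lt_max_of_lt_right hrpos
  let φ : C(characterSpace ℂ (Unitization ℂ B), ℂ) :=
    ⟨fun x => (((max ‖f h x‖ r) ^ 2)⁻¹ : ℝ), by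
      refine Complex.continuous_ofReal.comp (Continuous.inv₀ (by fun_prop) ?_)
      intro x
      exact (pow_pos (hm x) 2).ne'⟩
  let ψ : C(characterSpace ℂ (Unitization ℂ B), ℂ) :=
    ⟨fun x => (max (‖f h x‖ - r) 0 : ℝ), by fun_prop⟩
  obtain ⟨k, hk⟩ := hi φ (star h)
  obtain ⟨y, hy⟩ := hi ψ (star h)
  have hkx : ∀ x, f k x = (((max ‖f h x‖ r) ^ 2)⁻¹ : ℝ) * star (f h x) := by
    intro x; rw [hk]; simp [φ, map_star]
  have hyx : ∀ x, f y x = (max (‖f h x‖ - r) 0 : ℝ) * star (f h x) := by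
    intro x; rw [hy]; simp [ψ, map_star]
  have hmul : ∀ z : ℂ, star z * z = ((‖z‖ ^ 2 : ℝ) : ℂ) := by
    intro z
    have := Complex.conj_mul' z
    simpa using this
  have hkh : ∀ x, f (k * h) x = (((max ‖f h x‖ r) ^ 2)⁻¹ * ‖f h x‖ ^ 2 : ℝ) := by
    intro x
    rw [map_mul, ContinuousMap.mul_apply, hkx, mul_assoc, hmul]
    push_cast; ring
  refine ⟨r, hrpos, h * y, k, y, ?_, ?_, ?_, ?_, rfl⟩
  · intro hc
    have : f (h * y) x0 = 0 := by rw [hc]; simp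
    rw [map_mul, ContinuousMap.mul_apply, hyx] at this
    have h1 : max (‖f h x0‖ - r) 0 = r := by
      rw [max_eq_left] <;> rw [hr] <;> linarith [norm_nonneg (f h x0)]
    rw [h1] at this
    simp [hx0, hrpos.ne'] at this
  · rw [← hf, ← le_div_iff₀ hrpos]
    refine (ContinuousMap.norm_le _ (by positivity)).2 fun x => ?_
    rw [hkx, norm_mul, norm_star, Complex.norm_real, Real.norm_eq_abs, abs_of_pos (inv_pos.2 (pow_pos (hm x) 2)),
      inv_mul_eq_div, div_le_div_iff₀ (pow_pos (hm x) 2) hrpos, one_mul, pow_two]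
    exact mul_le_mul (le_max_left _ _) (le_max_right _ _) hrpos.le (hm x).le
  · rw [← hf]
    refine (ContinuousMap.norm_le _ zero_le_one).2 fun x => ?_
    rw [hkh, Complex.norm_real, Real.norm_eq_abs, abs_of_nonneg (by positivity), inv_mul_eq_div,
      div_le_one (pow_pos (hm x) 2)]
    exact pow_le_pow_left₀ (norm_nonneg _) (le_max_left _ _) 2
  · apply inj
    ext x
    rw [map_mul f (k * h), ContinuousMap.mul_apply, hkh, map_mul, ContinuousMap.mul_apply, hyx]
    by_cases hx : r < ‖f h x‖
    · rw [max_eq_left hx.le, inv_mul_cancel₀ (by have := hrpos.trans hx; positivity)]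
      simp
    · rw [max_eq_right (a := ‖f h x‖ - r) (by linarith)]
      simp

/-- Local bounded linear maps on a commutative C*-algebra are multipliers. -/
theorem rie_local {B : Type*} [NonUnitalCommCStarAlgebra B] (θ : B →ₗ[ℂ] B) (C : ℝ)
    (hC : ∀ b, ‖θ b‖ ≤ C * ‖b‖) (hloc : ∀ a b : B, a * b = 0 → a * θ b = 0) (d c : B) :
    θ d * c = d * θ c := by
  obtain ⟨f, hf, hi⟩ := rie_package B
  have inj : ∀ a b, f a = f b → a = b := by
    intro a b hab
    have : ‖f (a - b)‖ = 0 := by rw [map_sub, hab, sub_self, norm_zero]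
    rw [hf, norm_eq_zero, sub_eq_zero] at this
    exact this
  have key : ∀ x, ∀ z : B, f z x = 0 → f (θ z) x = 0 := by
    intro x z hz
    by_contra hne
    set p := θ z with hp
    have hC0 : 0 ≤ C := by
      by_contra hc
      have h1 := hC z
      have h2 : 0 < ‖θ z‖ := by
        rw [norm_pos_iff]; intro h0; apply hne; rw [hp, h0]; simp
      nlinarith [norm_nonneg z]
    have main : ∀ ε : ℝ, 0 < ε → ‖f (θ z) x‖ ≤ C * ε := by
      intro ε hε
      have hm : ∀ t, 0 < max ‖f z t‖ ε := fun t => lt_max_of_lt_right hε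
      let φ : C(characterSpace ℂ (Unitization ℂ B), ℂ) :=
        ⟨fun t => (max (‖f z t‖ - ε) 0 * (max ‖f z t‖ ε)⁻¹ : ℝ), by
          refine Complex.continuous_ofReal.comp (Continuous.mul (by fun_prop) 
            (Continuous.inv₀ (by fun_prop) ?_))
          intro t
          exact (hm t).ne'⟩
      let ψ : C(characterSpace ℂ (Unitization ℂ B), ℂ) :=
        ⟨fun t => (max (ε - ‖f z t‖) 0 : ℝ), by fun_prop⟩
      obtain ⟨w, hw⟩ := hi φ z
      obtain ⟨q, hq⟩ := hi ψ p
      have hqw : q * w = 0 := by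
        apply inj
        ext t
        rw [map_mul, hq, hw]
        simp only [ContinuousMap.mul_apply, map_zero, ContinuousMap.zero_apply, φ, ψ,
          ContinuousMap.coe_mk]
        rcases le_total ‖f z t‖ ε with ht | ht
        · rw [max_eq_right (a := ‖f z t‖ - ε) (by linarith)]; simp
        · rw [max_eq_right (a := ε - ‖f z t‖) (by linarith)]; simp
      have h1 : f (θ w) x = 0 := by
        have := congrArg (fun b => f b x) (hloc q w hqw)
        simp only [map_mul, hq, ContinuousMap.mul_apply, map_zero, ContinuousMap.zero_apply, ψ,
          ContinuousMap.coe_mk, hz, norm_zero, sub_zero, max_eq_left hε.le] at this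
        have hε' : (ε : ℂ) ≠ 0 := by exact_mod_cast hε.ne'
        simpa [hne, hε'] using this
      have h2 : ‖z - w‖ ≤ ε := by
        rw [← hf]
        refine (ContinuousMap.norm_le _ hε.le).2 fun t => ?_
        rw [map_sub, hw]
        simp only [ContinuousMap.sub_apply, ContinuousMap.mul_apply, φ, ContinuousMap.coe_mk]
        rcases le_total ‖f z t‖ ε with ht | ht
        · rw [max_eq_right (a := ‖f z t‖ - ε) (by linarith)]; simpa using ht
        · have hpos : 0 < ‖f z t‖ := hε.trans_le ht
          rw [max_eq_left (a := ‖f z t‖ - ε) (by linarith), max_eq_left ht]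
          have : f z t - (((‖f z t‖ - ε) * ‖f z t‖⁻¹ : ℝ) : ℂ) * f z t
              = ((ε * ‖f z t‖⁻¹ : ℝ) : ℂ) * f z t := by
            have h3 : ((‖f z t‖ - ε) * ‖f z t‖⁻¹ : ℝ) = 1 - ε * ‖f z t‖⁻¹ := by
              field_simp
            rw [h3]; push_cast; ring
          rw [this, norm_mul, Complex.norm_real, Real.norm_eq_abs, abs_of_nonneg (by positivity),
            mul_assoc, inv_mul_cancel₀ hpos.ne', mul_one]
      calc ‖f (θ z) x‖ = ‖f (θ (z - w)) x‖ := by rw [map_sub, map_sub, ContinuousMap.sub_apply, h1, sub_zero]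
        _ ≤ ‖f (θ (z - w))‖ := ContinuousMap.norm_coe_le_norm _ _
        _ = ‖θ (z - w)‖ := hf _
        _ ≤ C * ‖z - w‖ := hC _
        _ ≤ C * ε := by gcongr
    have hpos : 0 < ‖f (θ z) x‖ := norm_pos_iff.2 hne
    have := main (‖f (θ z) x‖ / (2 * (C + 1))) (by positivity)
    have h4 : C * (‖f (θ z) x‖ / (2 * (C + 1))) < ‖f (θ z) x‖ := by
      rw [← mul_div_assoc, div_lt_iff₀ (by positivity)]
      nlinarith
    linarith
  apply inj
  ext x
  have := key x (f c x • d - f d x • c) (by simp [mul_comm])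
  simp only [map_sub, map_smul, ContinuousMap.sub_apply, ContinuousMap.smul_apply, smul_eq_mul] at this
  simp only [map_mul, ContinuousMap.mul_apply]
  linear_combination this

end CommPart

section RieSets

variable {A : Type*} [NonUnitalCStarAlgebra A] [PartialOrder A] [StarOrderedRing A]

/-- The star subalgebra attached to an inclusion. -/
def rieSub (D : Set A) (hI : IsInclusion D) : NonUnitalStarSubalgebra ℂ A where
  carrier := D
  add_mem' := fun {a b} ha hb => hI.add_mem a ha b hb
  zero_mem' := hI.zero_mem
  mul_mem' := fun {a b} ha hb => hI.mul_mem a ha b hb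
  smul_mem' := fun c x hx => hI.smul_mem c x hx
  star_mem' := fun {a} ha => hI.star_mem a ha

/-- An abelian inclusion gives a commutative C*-algebra. -/
@[reducible] noncomputable def rieComm (D : Set A) (hI : IsInclusion D)
    (hab : ∀ x ∈ D, ∀ y ∈ D, x * y = y * x) : NonUnitalCommCStarAlgebra (rieSub D hI) :=
  { NonUnitalStarSubalgebra.nonUnitalCStarAlgebra (rieSub D hI) (h_closed := hI.isClosed) with
    mul_comm := fun a b => Subtype.ext (hab a a.2 b b.2) }

theorem rie_bump_set (D : Set A) (hI : IsInclusion D)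
    (hab : ∀ x ∈ D, ∀ y ∈ D, x * y = y * x) (h : A) (hD : h ∈ D) (hh : h ≠ 0) :
    ∃ r : ℝ, 0 < r ∧ ∃ g ∈ D, ∃ k ∈ D, ∃ y ∈ D, g ≠ 0 ∧ ‖k‖ * r ≤ 1 ∧ ‖k * h‖ ≤ 1 ∧
      k * h * g = g ∧ g = h * y := by
  let _ := rieComm D hI hab
  obtain ⟨r, hr, g, k, y, h1, h2, h3, h4, h5⟩ := rie_bump (B := rieSub D hI) ⟨h, hD⟩
    (fun hc => hh (congrArg Subtype.val hc))
  exact ⟨r, hr, g, g.2, k, k.2, y, y.2, fun hc => h1 (Subtype.ext hc), h2, h3,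
    congrArg Subtype.val h4, congrArg Subtype.val h5⟩

theorem rie_local_set (D : Set A) (hI : IsInclusion D)
    (hab : ∀ x ∈ D, ∀ y ∈ D, x * y = y * x) (x : A) (hx : ∀ d ∈ D, x * d * star x ∈ D)
    (hloc : ∀ a ∈ D, ∀ b ∈ D, a * b = 0 → a * x * b = 0) :
    ∀ d ∈ D, ∀ c ∈ D, (x * d * star x) * c = d * (x * c * star x) := by
  intro d hd c hc
  let _ := rieComm D hI hab
  let θ : rieSub D hI →ₗ[ℂ] rieSub D hI :=
    { toFun := fun d => ⟨x * d * star x, hx d d.2⟩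
      map_add' := fun a b => Subtype.ext (by simp [mul_add, add_mul])
      map_smul' := fun a b => Subtype.ext (by
        change x * (a • (b : A)) * star x = a • (x * (b : A) * star x)
        rw [mul_smul_comm, smul_mul_assoc]) }
  have := rie_local θ (‖x‖ * ‖star x‖) ?_ ?_ ⟨d, hd⟩ ⟨c, hc⟩
  · exact congrArg Subtype.val this
  · intro b
    change ‖x * (b : A) * star x‖ ≤ ‖x‖ * ‖star x‖ * ‖(b : A)‖
    calc _ ≤ ‖x‖ * ‖(b : A)‖ * ‖star x‖ :=
          (norm_mul_le _ _).trans (mul_le_mul_of_nonneg_right (norm_mul_le _ _) (norm_nonneg _))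
      _ = _ := by ring
  · intro a b h
    have := hloc a a.2 b b.2 (congrArg Subtype.val h)
    apply Subtype.ext
    change (a : A) * (x * b * star x) = 0
    rw [← mul_assoc, ← mul_assoc, this, zero_mul]

theorem rie_zero_of_mul (D : Set A) (hI : IsInclusion D) (T : A) (hT : ∀ c ∈ D, T * c = 0) :
    T = 0 := by
  by_contra hne
  have hp : 0 < ‖star T‖ := by simpa using hne
  obtain ⟨e, he, -, -, h⟩ := hI.approxUnit {star T} ‖star T‖ hp
  have h1 := h (star T) (by simp)
  have h2 : e * star T = 0 := by
    have := congrArg star (hT (star e) (hI.star_mem e he))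
    simpa using this
  rw [h2, zero_sub, norm_neg] at h1
  exact lt_irrefl _ h1

theorem rie_self_zero {x : A} (h : x * star x = 0) : x = 0 :=
  CStarRing.mul_star_self_eq_zero_iff x |>.1 h

theorem rie_commute (D : Set A) (hI : IsInclusion D)
    (hab : ∀ x ∈ D, ∀ y ∈ D, x * y = y * x) (x : A) (hx : ∀ d ∈ D, x * d * star x ∈ D)
    (hloc : ∀ a ∈ D, ∀ b ∈ D, a * b = 0 → a * x * b = 0) :
    ∀ d ∈ D, x * d = d * x := by
  have h1 := rie_local_set D hI hab x hx hloc
  have h2 : ∀ d ∈ D, ∀ y ∈ D, x * (d * y) * star x = d * (x * y * star x) := by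
    intro d hd y hy
    rw [← sub_eq_zero]
    apply rie_zero_of_mul D hI
    intro c hc
    rw [sub_mul, h1 _ (hI.mul_mem d hd y hy) c hc, mul_assoc d (x * y * star x) c, h1 y hy c hc]
    simp only [mul_assoc, sub_self]
  intro d hd
  rw [← sub_eq_zero]
  apply rie_zero_of_mul D hI
  intro c hc
  apply rie_self_zero
  have hc' := hI.mul_mem c hc _ (hI.star_mem c hc)
  have hd' := hI.star_mem d hd
  have e1 := h2 d hd _ (hI.mul_mem _ hc' _ hd')
  have e2 := h2 d hd _ hc'
  have e : (x * d - d * x) * c * star ((x * d - d * x) * c)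
     = (x * (d * (c * star c * star d)) * star x - d * (x * (c * star c * star d) * star x))
      - (x * (d * (c * star c)) * star x - d * (x * (c * star c) * star x)) * star d := by
    simp only [star_mul, star_sub, sub_mul, mul_sub, mul_assoc]
  rw [e, e1, e2]
  simp

/-- Localisation of normalizers. -/
theorem rie_loc_norm (D : Set A) (E : A → A) (hC : IsCartanInclusion D E) (n : A)
    (hn : IsNormalizer D n) (g : A) (hg : g ∈ D) (hg0 : g ≠ 0) :
    ∃ y ∈ D, g * y ≠ 0 ∧ (g * y) * (n - E n) * (g * y) = 0 := by
  have hI := hC.regularInclusion.1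
  have hab := hC.abelian
  by_cases hcase : ∀ a ∈ D, ∀ b ∈ D, a * b = 0 → a * (g * n * g) * b = 0
  · have hcom := rie_commute D hI hab (g * n * g) (by
      intro d hd
      have := hI.mul_mem _ (hI.mul_mem _ hg _ (hn.1 _ (hI.mul_mem _ (hI.mul_mem _ hg _ hd) _
        (hI.star_mem _ hg)))) _ (hI.star_mem _ hg)
      simpa [mul_assoc] using this) hcase
    have h1 := hC.condExp.fixes _ (hC.maximalAbelian _ hcom)
    rw [hC.condExp.bimodule g hg n g hg] at h1
    refine ⟨star g, hI.star_mem g hg, fun h => hg0 (rie_self_zero h), ?_⟩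
    have : g * star g * (n - E n) * (g * star g)
        = star g * (g * n * g - g * E n * g) * star g := by
      conv_lhs => rw [hab g hg _ (hI.star_mem g hg)]
      rw [mul_assoc (star g * g), mul_assoc (star g), ← hab g hg _ (hI.star_mem g hg)]
      simp only [mul_sub, sub_mul, mul_assoc]
    rw [this, h1]
    simp
  · push Not at hcase
    obtain ⟨f1, h1, f2, h2, h12, hne⟩ := hcase
    set a := f1 * g with ha
    set b := g * f2 with hb
    have haD : a ∈ D := hI.mul_mem _ h1 _ hg
    have hbD : b ∈ D := hI.mul_mem _ hg _ h2
    have hne' : a * n * b ≠ 0 := by simpa [ha, hb, mul_assoc] using hne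
    have hba : b * star a = 0 := by
      apply rie_self_zero
      have : b * star a * star (b * star a) = b * (star a * (a * star b)) := by
        simp [mul_assoc]
      rw [this, ← mul_assoc (star a), ← hab a haD _ (hI.star_mem _ haD), mul_assoc a,
        ← mul_assoc b]
      have : b * a = 0 := by
        rw [hab b hbD a haD, ha, hb, hab f1 h1 g hg]
        have : g * f1 * (g * f2) = g * (f1 * g) * f2 := by simp [mul_assoc]
        rw [this, hab f1 h1 g hg, mul_assoc, mul_assoc, h12]
        simp
      rw [this, zero_mul]
    -- the cut-off
    set q := star n * (star a * a) * n with hq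
    have hqD : q ∈ D := hn.2 _ (hI.mul_mem _ (hI.star_mem _ haD) _ haD)
    set h := star (a * n * b) * (a * n * b) with hh
    have hh1 : h = star b * q * b := by simp [hh, hq, mul_assoc]
    have hh2 : h = g * (f2 * star b * q) := by
      rw [hh1, hab _ (hI.mul_mem _ (hI.star_mem _ hbD) _ hqD) b hbD, hb]
      simp [mul_assoc]
    have hyD : f2 * star b * q ∈ D := hI.mul_mem _ (hI.mul_mem _ h2 _ (hI.star_mem _ hbD)) _ hqD
    have hhD : h ∈ D := by rw [hh2]; exact hI.mul_mem _ hg _ hyD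
    have hnh : h * n * h = 0 := by
      have e : h * n * h = star b * star n * star a * a * n * (b * (n * star b * star n) * star a)
          * a * n * b := by
        simp [hh, mul_assoc]
      have e2 : b * (n * star b * star n) * star a = 0 := by
        rw [hab b hbD _ (hn.1 _ (hI.star_mem _ hbD)), mul_assoc, hba, mul_zero]
      rw [e, e2]; simp
    have hEh : h * E n * h = 0 := by
      rw [← hC.condExp.bimodule h hhD n h hhD, hnh]
      have := hC.condExp.map_smul 0 0
      simpa using this
    refine ⟨f2 * star b * q, hyD, ?_, ?_⟩
    · rw [← hh2]
      intro hc
      exact hne' (CStarRing.star_mul_self_eq_zero_iff _ |>.1 hc)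
    · rw [← hh2, mul_sub, sub_mul, hnh, hEh, sub_zero]

theorem rie_loc_span (D : Set A) (E : A → A) (hC : IsCartanInclusion D E) (b : A)
    (hb : b ∈ Submodule.span ℂ {n : A | IsNormalizer D n}) :
    ∀ g ∈ D, g ≠ 0 → ∃ y ∈ D, g * y ≠ 0 ∧ (g * y) * (b - E b) * (g * y) = 0 := by
  have hI := hC.regularInclusion.1
  have hab := hC.abelian
  induction hb using Submodule.span_induction with
  | mem n hn => intro g hg hg0; exact rie_loc_norm D E hC n hn g hg hg0
  | zero =>
    intro g hg hg0
    have := hC.condExp.map_smul 0 0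
    exact ⟨star g, hI.star_mem g hg, fun h => hg0 (rie_self_zero h), by
      simp only [zero_smul] at this; simp [this]⟩
  | add u v _ _ hu hv =>
    intro g hg hg0
    obtain ⟨y, hy, h1, h2⟩ := hu g hg hg0
    obtain ⟨z, hz, h3, h4⟩ := hv (g * y) (hI.mul_mem _ hg _ hy) h1
    refine ⟨y * z, hI.mul_mem _ hy _ hz, by rwa [← mul_assoc], ?_⟩
    rw [← mul_assoc g y z, hC.condExp.map_add]
    have e : g * y * z * (u + v - (E u + E v)) * (g * y * z)
      = z * ((g * y) * (u - E u) * (g * y)) * z + g * y * z * (v - E v) * (g * y * z) := by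
      have hz' := hab (g * y) (hI.mul_mem _ hg _ hy) z hz
      have e1 : g * y * z * (u + v - (E u + E v)) * (g * y * z) =
        g * y * z * (u - E u) * (g * y * z) + g * y * z * (v - E v) * (g * y * z) := by
        rw [← add_mul, ← mul_add]; congr 2; abel
      rw [e1]
      congr 1
      conv_lhs => rw [hz']
      conv_lhs => rw [← hz']
      nth_rewrite 1 [hz']
      simp only [mul_assoc]
    rw [e, h2, h4]
    simp
  | smul c u _ hu =>
    intro g hg hg0
    obtain ⟨y, hy, h1, h2⟩ := hu g hg hg0
    refine ⟨y, hy, h1, ?_⟩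
    rw [hC.condExp.map_smul, ← smul_sub, mul_smul_comm, smul_mul_assoc, h2, smul_zero]

theorem rie_E_bdd (D : Set A) (E : A → A) (hE : IsCondExp D E) :
    ∃ C : ℝ, 0 ≤ C ∧ ∀ a, ‖E a‖ ≤ C * ‖a‖ := by
  let f : A →ₗ[ℂ] A := { toFun := E, map_add' := hE.map_add, map_smul' := hE.map_smul }
  obtain ⟨C, hC⟩ := PositiveLinearMap.exists_norm_apply_le (PositiveLinearMap.mk₀ f hE.positive)
  exact ⟨C, C.2, hC⟩

/-- The key vanishing lemma for Cartan inclusions. -/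
theorem rie_cartan (D : Set A) (E : A → A) (hC : IsCartanInclusion D E) (M : Set A)
    (hM : ∀ d ∈ D, ∀ m ∈ M, d * m ∈ M) (hM0 : ∀ d ∈ D, (∀ m ∈ M, d * m = 0) → d = 0)
    (a : A) (ha : ∀ m ∈ M, a * m = 0) : a = 0 := by
  have hI := hC.regularInclusion.1
  have hab := hC.abelian
  suffices H : ∀ a, (∀ m ∈ M, a * m = 0) → E a = 0 by
    refine hC.condExp.faithful a (H _ fun m hm => ?_)
    rw [mul_assoc, ha m hm, mul_zero]
  clear ha a
  intro a ha
  by_contra hne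
  obtain ⟨C, hC0, hEC⟩ := rie_E_bdd D E hC.condExp
  set h := E a with hh
  have hhD : h ∈ D := hC.condExp.mem a
  obtain ⟨r, hr, g, hgD, k, hkD, _, _, hg0, hk1, _, hkg, _⟩ := rie_bump_set D hI hab h hhD hne
  obtain ⟨b, hb, hab'⟩ := hC.regularInclusion.2.exists_dist_lt a
    (show 0 < r / (2 * (1 + C)) by positivity)
  rw [dist_eq_norm] at hab'
  obtain ⟨y, hy, hgy0, hgy⟩ := rie_loc_span D E hC b hb g hgD hg0
  set e := g * y with he
  have heD : e ∈ D := hI.mul_mem _ hgD _ hy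
  obtain ⟨_, _, e', he'D, v, hvD, z, hzD, he'0, _, hu1, hue', he'z⟩ :=
    rie_bump_set D hI hab e heD hgy0
  set u := v * e with hu
  have huD : u ∈ D := hI.mul_mem _ hvD _ heD
  obtain ⟨m, hm, hem⟩ : ∃ m ∈ M, e' * m ≠ 0 := by
    by_contra! hc
    exact he'0 (hM0 e' he'D hc)
  set l := e' * m with hl
  have hlM : l ∈ M := hM _ he'D _ hm
  have hul : u * l = l := by rw [hl, ← mul_assoc, hue']
  have hal := ha l hlM
  have hkl : k * (h * l) = l := by
    have : k * h * e' = e' := by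
      rw [he'z, he, ← mul_assoc, ← mul_assoc, hkg]
    rw [← mul_assoc, hl, ← mul_assoc, this]
  have hubu : u * (b - E b) * u = 0 := by
    have : u * (b - E b) * u = v * (e * (b - E b) * e) * v := by
      nth_rewrite 2 [hu]
      rw [hab v hvD e heD, hu]
      simp only [mul_assoc]
    rw [this, hgy]; simp
  have h1 : u * b * l = E b * l := by
    have h2 : u * (b - E b) * u * l = 0 := by rw [hubu, zero_mul]
    rw [mul_assoc _ u l, hul, mul_sub, sub_mul, sub_eq_zero] at h2
    rw [h2, hab u huD _ (hC.condExp.mem b), mul_assoc, hul]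
  have hlpos : 0 < ‖l‖ := norm_pos_iff.2 hem
  have hEsub : E a - E b = E (a - b) := by
    have h2 := hC.condExp.map_add (a - b) b
    rw [sub_add_cancel] at h2
    rw [h2, add_sub_cancel_right]
  have h3 : h * l = E (a - b) * l - u * (a - b) * l := by
    rw [← hEsub, sub_mul, mul_sub, sub_mul, h1, mul_assoc u a l, hal]
    simp [hh]
  have h4 : ‖h * l‖ ≤ (C * ‖a - b‖ + ‖a - b‖) * ‖l‖ := by
    rw [h3]
    have i1 : ‖E (a - b) * l‖ ≤ C * ‖a - b‖ * ‖l‖ :=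
      (norm_mul_le _ _).trans (mul_le_mul_of_nonneg_right (hEC _) (norm_nonneg _))
    have i2 : ‖u * (a - b) * l‖ ≤ ‖a - b‖ * ‖l‖ := by
      refine (norm_mul_le _ _).trans (mul_le_mul_of_nonneg_right ?_ (norm_nonneg _))
      refine (norm_mul_le _ _).trans ?_
      exact mul_le_of_le_one_left (norm_nonneg _) hu1
    have := norm_sub_le (E (a - b) * l) (u * (a - b) * l)
    linarith
  have h5 : ‖l‖ * r ≤ ‖h * l‖ := by
    have i1 : ‖l‖ ≤ ‖k‖ * ‖h * l‖ := by
      conv_lhs => rw [← hkl]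
      exact norm_mul_le _ _
    nlinarith [norm_nonneg (h * l)]
  have h6 : C * ‖a - b‖ + ‖a - b‖ < r := by
    rw [lt_div_iff₀ (by positivity)] at hab'
    nlinarith
  nlinarith

end RieSets

section RieAnn

variable {A : Type*} [NonUnitalCStarAlgebra A] [PartialOrder A] [StarOrderedRing A]

theorem rie_ann_anti (C : Set A) {X Y : Set A} (h : X ⊆ Y) : Ann C Y ⊆ Ann C X :=
  fun _ hc => ⟨hc.1, fun x hx => hc.2 x (h hx)⟩

theorem rie_sub_ann (C : Set A) {X : Set A} (h : X ⊆ C) : X ⊆ Ann C (Ann C X) :=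
  fun x hx => ⟨h hx, fun _ hc => ⟨(hc.2 x hx).2, (hc.2 x hx).1⟩⟩

theorem rie_ann3 (X : Set A) :
    Ann Set.univ (Ann Set.univ (Ann Set.univ X)) = Ann Set.univ X :=
  Set.Subset.antisymm (rie_ann_anti _ (rie_sub_ann _ (Set.subset_univ _)))
    (rie_sub_ann _ (Set.subset_univ _))

/-- Star-closed sets whose left annihilator is a two-sided ideal. -/
structure RieGood (S : Set A) : Prop where
  star_mem : ∀ s ∈ S, star s ∈ S
  right : ∀ x, (∀ s ∈ S, x * s = 0) → ∀ b, ∀ s ∈ S, x * b * s = 0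

theorem RieGood.mem {S : Set A} (hS : RieGood S) (x : A) :
    x ∈ Ann Set.univ S ↔ ∀ s ∈ S, x * s = 0 := by
  refine ⟨fun h s hs => (h.2 s hs).1, fun h => ⟨trivial, fun s hs => ⟨h s hs, ?_⟩⟩⟩
  apply rie_self_zero
  have := hS.right x h (star x) (star s) (hS.star_mem s hs)
  rw [star_mul, mul_assoc, ← mul_assoc x, this, mul_zero]

theorem rie_ann_star {S : Set A} (hS : ∀ s ∈ S, star s ∈ S) :
    ∀ x ∈ Ann Set.univ S, star x ∈ Ann Set.univ S := by
  intro x hx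
  refine ⟨trivial, fun s hs => ?_⟩
  have := hx.2 _ (hS s hs)
  constructor
  · simpa using congrArg star this.2
  · simpa using congrArg star this.1

theorem RieGood.ideal {S : Set A} (hS : RieGood S) :
    IsClosedIdealOf Set.univ (Ann Set.univ S) where
  subset := Set.subset_univ _
  zero_mem := (hS.mem 0).2 fun s _ => zero_mul s
  add_mem := fun x hx y hy => (hS.mem _).2 fun s hs => by
    rw [add_mul, (hS.mem x).1 hx s hs, (hS.mem y).1 hy s hs, add_zero]
  smul_mem := fun c x hx => (hS.mem _).2 fun s hs => by
    rw [smul_mul_assoc, (hS.mem x).1 hx s hs, smul_zero]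
  mul_left := fun c _ x hx => (hS.mem _).2 fun s hs => by
    rw [mul_assoc, (hS.mem x).1 hx s hs, mul_zero]
  mul_right := fun x hx c _ => (hS.mem _).2 fun s hs => hS.right x ((hS.mem x).1 hx) c s hs
  isClosed := by
    have : Ann Set.univ S = ⋂ s ∈ S, {x : A | x * s = 0} := by
      ext x; rw [hS.mem]; simp
    rw [this]
    exact isClosed_biInter fun s _ => isClosed_eq (by fun_prop) continuous_const

theorem rie_good_of_ideal {L : Set A} (hL : IsClosedIdealOf Set.univ L)
    (hs : ∀ s ∈ L, star s ∈ L) : RieGood L :=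
  ⟨hs, fun x hx b s h => by rw [mul_assoc]; exact hx _ (hL.mul_left b trivial s h)⟩

theorem RieGood.ann {S : Set A} (hS : RieGood S) : RieGood (Ann Set.univ S) :=
  rie_good_of_ideal hS.ideal (rie_ann_star hS.star_mem)

theorem RieGood.regular {S : Set A} (hS : RieGood S) : IsRegularIdealOf Set.univ (Ann Set.univ S) :=
  ⟨hS.ideal, rie_ann3 S⟩

theorem rie_regular_star {J : Set A} (hJ : IsRegularIdealOf Set.univ J) : ∀ s ∈ J, star s ∈ J := by
  have h1 : ∀ c ∈ Ann Set.univ J, star c ∈ Ann Set.univ J := by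
    intro c hc
    refine ⟨trivial, fun j hj => ⟨?_, ?_⟩⟩
    · apply (CStarRing.star_mul_self_eq_zero_iff _).1
      have := (hc.2 _ (hJ.1.mul_left (star c) trivial j hj)).1
      rw [star_mul, star_star, mul_assoc, this, mul_zero]
    · apply rie_self_zero
      have := (hc.2 _ (hJ.1.mul_right j hj (star c) trivial)).2
      rw [star_mul, star_star, ← mul_assoc, this, zero_mul]
  have h2 := rie_ann_star h1
  rw [hJ.2] at h2
  exact h2

theorem rie_regular_good {J : Set A} (hJ : IsRegularIdealOf Set.univ J) : RieGood J :=
  rie_good_of_ideal hJ.1 (rie_regular_star hJ)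

theorem rie_right (S N : Set A) (hN : Dense (Submodule.span ℂ N : Set A))
    (hS : ∀ n ∈ N, ∀ s ∈ S, n * (s * star s) * star n ∈ S) (x : A) (hx : ∀ s ∈ S, x * s = 0) :
    ∀ b, ∀ s ∈ S, x * b * s = 0 := by
  intro b s hs
  have hcl : IsClosed {b : A | x * b * s = 0} := isClosed_eq (by fun_prop) continuous_const
  have hsub : (Submodule.span ℂ N : Set A) ⊆ {b : A | x * b * s = 0} := by
    intro b hb
    induction hb using Submodule.span_induction with
    | mem n hn =>
      apply rie_self_zero
      have := hx _ (hS n hn s hs)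
      have e : x * n * s * star (x * n * s) = x * (n * (s * star s) * star n) * star x := by
        simp [mul_assoc]
      rw [e, this, zero_mul]
    | zero => simp
    | add u v _ _ hu hv =>
      simp only [Set.mem_setOf_eq] at hu hv ⊢
      rw [mul_add, add_mul, hu, hv, add_zero]
    | smul c u _ hu =>
      simp only [Set.mem_setOf_eq] at hu ⊢
      rw [mul_smul_comm, smul_mul_assoc, hu, smul_zero]
  exact hcl.closure_subset_iff.2 hsub (hN b)

/-- `J ∩ D` is good. -/
theorem rie_good_inter (D : Set A) (hI : IsInclusion D)
    (hR : Dense (↑(Submodule.span ℂ {n : A | IsNormalizer D n}) : Set A)) (J : Set A)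
    (hJ : IsClosedIdealOf Set.univ J) (hJs : ∀ s ∈ J, star s ∈ J) : RieGood (J ∩ D) where
  star_mem := fun s hs => ⟨hJs s hs.1, hI.star_mem s hs.2⟩
  right := rie_right _ _ hR fun n hn s hs =>
    ⟨hJ.mul_right _ (hJ.mul_left _ trivial _ (hJ.mul_right _ hs.1 _ trivial)) _ trivial,
      hn.1 _ (hI.mul_mem _ hs.2 _ (hI.star_mem _ hs.2))⟩

/-- In a pseudo-Cartan inclusion, `J` and `J ∩ D` have the same annihilator. -/
theorem rie_pseudo (D : Set A) (hD : IsPseudoCartan D) (J : Set A)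
    (hJ : IsClosedIdealOf Set.univ J) (hJs : ∀ s ∈ J, star s ∈ J) :
    Ann Set.univ (J ∩ D) = Ann Set.univ J := by
  have hK := rie_good_inter D hD.inclusion hD.regular J hJ hJs
  have hJg := rie_good_of_ideal hJ hJs
  refine Set.Subset.antisymm ?_ (rie_ann_anti _ Set.inter_subset_left)
  have hId := hK.ideal
  set I := Ann Set.univ (J ∩ D) with hIdef
  have hM : IsClosedIdealOf Set.univ (I ∩ J) :=
    { subset := Set.subset_univ _
      zero_mem := ⟨hId.zero_mem, hJ.zero_mem⟩
      add_mem := fun x hx y hy => ⟨hId.add_mem x hx.1 y hy.1, hJ.add_mem x hx.2 y hy.2⟩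
      smul_mem := fun c x hx => ⟨hId.smul_mem c x hx.1, hJ.smul_mem c x hx.2⟩
      mul_left := fun c hc x hx => ⟨hId.mul_left c hc x hx.1, hJ.mul_left c hc x hx.2⟩
      mul_right := fun x hx c hc => ⟨hId.mul_right x hx.1 c hc, hJ.mul_right x hx.2 c hc⟩
      isClosed := hId.isClosed.inter hJ.isClosed }
  have hzero : ∀ x ∈ I ∩ J, x = 0 := by
    by_contra! hne
    obtain ⟨z, hz, hz0⟩ := hD.iip_A _ hM hne
    have hclosed : IsClosed (RelComm D) := by
      have : RelComm D = ⋂ d ∈ D, {a : A | a * d = d * a} := by ext; simp [RelComm]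
      rw [this]
      exact isClosed_biInter fun s _ => isClosed_eq (by fun_prop) (by fun_prop)
    have hmul : ∀ c ∈ RelComm D, ∀ x ∈ RelComm D, c * x ∈ RelComm D := by
      intro c hc x hx d hd
      rw [mul_assoc, hx d hd, ← mul_assoc, hc d hd, mul_assoc]
    have hW : IsClosedIdealOf (RelComm D) ((I ∩ J) ∩ RelComm D) :=
      { subset := Set.inter_subset_right
        zero_mem := ⟨hM.zero_mem, fun d _ => by simp⟩
        add_mem := fun x hx y hy => ⟨hM.add_mem x hx.1 y hy.1, fun d hd => by
          rw [add_mul, mul_add, hx.2 d hd, hy.2 d hd]⟩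
        smul_mem := fun c x hx => ⟨hM.smul_mem c x hx.1, fun d hd => by
          rw [smul_mul_assoc, mul_smul_comm, hx.2 d hd]⟩
        mul_left := fun c hc x hx => ⟨hM.mul_left c trivial x hx.1, hmul c hc x hx.2⟩
        mul_right := fun x hx c hc => ⟨hM.mul_right x hx.1 c trivial, hmul x hx.2 c hc⟩
        isClosed := hM.isClosed.inter hclosed }
    obtain ⟨w, hw, hw0⟩ := hD.iip_relComm _ hW ⟨z, hz, hz0⟩
    apply hw0
    apply rie_self_zero
    exact (hw.1.1.1.2 _ (hK.star_mem w ⟨hw.1.1.2, hw.2⟩)).1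
  intro x hx
  refine (hJg.mem x).2 fun j hj => hzero _ ⟨hId.mul_right x hx j trivial, hJ.mul_left x trivial j hj⟩

/-- In a Cartan inclusion, a regular ideal `J` and `J ∩ D` have the same annihilator. -/
theorem rie_cartan_ann (D : Set A) (E : A → A) (hC : IsCartanInclusion D E) (J : Set A)
    (hJ : IsRegularIdealOf Set.univ J) :
    Ann Set.univ (J ∩ D) = Ann Set.univ J := by
  have hI := hC.regularInclusion.1
  have hJs := rie_regular_star hJ
  have hK := rie_good_inter D hI hC.regularInclusion.2 J hJ.1 hJs
  have hJg := rie_good_of_ideal hJ.1 hJs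
  have hL := hJg.ann
  refine Set.Subset.antisymm ?_ (rie_ann_anti _ Set.inter_subset_left)
  intro x hx
  refine (hJg.mem x).2 fun j hj => ?_
  apply rie_cartan D E hC ((J ∩ D) ∪ Ann Set.univ J)
  · rintro d hd m (hm | hm)
    · exact Or.inl ⟨hJ.1.mul_left d trivial m hm.1, hI.mul_mem d hd m hm.2⟩
    · exact Or.inr (hJg.ideal.mul_left d trivial m hm)
  · intro d hd h
    have hdJ : d ∈ J := by
      rw [← hJ.2]
      exact (hL.mem d).2 fun s hs => h s (Or.inr hs)
    apply rie_self_zero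
    exact h _ (Or.inl (hK.star_mem d ⟨hdJ, hd⟩))
  · rintro m (hm | hm)
    · exact hK.right x ((hK.mem x).1 hx) j m hm
    · rw [mul_assoc, (hm.2 j hj).2, mul_zero]

/-- Annihilators of subsets of `D` are detected by the conditional expectation. -/
theorem rie_E_lemma (D : Set A) (E : A → A) (hC : IsCartanInclusion D E) (S T : Set A)
    (hS : S ⊆ D) (hT : T ⊆ D)
    (h : ∀ e ∈ D, (∀ s ∈ S, e * s = 0) → ∀ t ∈ T, e * t = 0) (x : A) (hx : ∀ s ∈ S, x * s = 0) :
    ∀ t ∈ T, x * t = 0 := by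
  have hI := hC.regularInclusion.1
  have hab := hC.abelian
  have hE0 : E 0 = 0 := by
    have := hC.condExp.map_smul 0 0
    simpa using this
  have hform : ∀ d ∈ D, E (star (x * d) * (x * d)) = star d * E (star x * x) * d := by
    intro d hd
    rw [← hC.condExp.bimodule _ (hI.star_mem d hd) _ d hd]
    simp [mul_assoc]
  have heD := hC.condExp.mem (star x * x)
  set e := E (star x * x) with he
  intro t ht
  apply hC.condExp.faithful
  rw [hform t (hT ht), mul_assoc, h e heD ?_ t ht, mul_zero]
  intro s hs
  have h1 := hform s (hS hs)
  rw [hx s hs, mul_zero, hE0] at h1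
  apply rie_self_zero
  have hsD := hS hs
  have hsD' := hI.star_mem s hsD
  have : e * s * star (e * s) = star s * e * s * star e := by
    rw [star_mul, mul_assoc e, ← mul_assoc s, hab s hsD _ hsD', mul_assoc, ← mul_assoc e,
      hab e heD _ hsD']
    simp only [mul_assoc]
  rw [this, ← h1, zero_mul]

theorem rie_annD_star (D : Set A) (hI : IsInclusion D) (hab : ∀ x ∈ D, ∀ y ∈ D, x * y = y * x)
    (Q : Set A) (hQ : Q ⊆ D) : ∀ p ∈ Ann D Q, star p ∈ Ann D Q := by
  intro p hp
  have hpD := hp.1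
  have hpD' := hI.star_mem p hpD
  have key : ∀ q ∈ Q, star p * q = 0 := by
    intro q hq
    apply rie_self_zero
    have hq' := hI.star_mem q (hQ hq)
    rw [star_mul, star_star, hab _ hq' p hpD, ← mul_assoc, mul_assoc (star p) q p, (hp.2 q hq).2,
      mul_zero, zero_mul]
  refine ⟨hpD', fun q hq => ⟨key q hq, ?_⟩⟩
  rw [hab q (hQ hq) _ hpD', key q hq]

theorem rie_ann_annD (D : Set A) (E : A → A) (hC : IsCartanInclusion D E) (S : Set A)
    (hS : S ⊆ D) (hSs : ∀ s ∈ S, star s ∈ S) :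
    Ann Set.univ (Ann D (Ann D S)) = Ann Set.univ S := by
  have hI := hC.regularInclusion.1
  have hab := hC.abelian
  refine Set.Subset.antisymm (rie_ann_anti _ (rie_sub_ann _ hS)) ?_
  have key : ∀ x ∈ Ann Set.univ S, ∀ t ∈ Ann D (Ann D S), x * t = 0 := by
    intro x hx
    refine rie_E_lemma D E hC S _ hS (fun _ h => h.1) ?_ x fun s hs => (hx.2 s hs).1
    intro e heD he t ht
    exact (ht.2 e ⟨heD, fun s hs => ⟨he s hs, by rw [hab s (hS hs) e heD, he s hs]⟩⟩).2
  intro x hx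
  refine ⟨trivial, fun t ht => ⟨key x hx t ht, ?_⟩⟩
  have := key _ (rie_ann_star hSs x hx) _ (rie_annD_star D hI hab _ (fun _ h => h.1) t ht)
  simpa using congrArg star this

end RieAnn

section RieMain

variable {A : Type*} [NonUnitalCStarAlgebra A] [PartialOrder A] [StarOrderedRing A]
variable {A₁ : Type*} [NonUnitalCStarAlgebra A₁] [PartialOrder A₁] [StarOrderedRing A₁]

theorem rie_good_image (D : Set A) (D₁ : Set A₁) (α : A →⋆ₙₐ[ℂ] A₁) (E : A₁ → A₁)
    (hD : IsPseudoCartan D) (henv : IsCartanEnvelope D D₁ α E) (J : Set A)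
    (hJ : IsClosedIdealOf Set.univ J) (hJs : ∀ s ∈ J, star s ∈ J) :
    RieGood (⇑α '' (J ∩ D)) := by
  have hI := henv.cartan.regularInclusion.1
  have hab := henv.cartan.abelian
  set S := ⇑α '' (J ∩ D) with hSdef
  have hSD : S ⊆ D₁ := by
    rintro _ ⟨d, hd, rfl⟩; exact henv.maps d hd.2
  have hSs : ∀ s ∈ S, star s ∈ S := by
    rintro _ ⟨d, hd, rfl⟩
    exact ⟨star d, ⟨hJs d hd.1, hD.inclusion.star_mem d hd.2⟩, map_star α d⟩
  have hα : Continuous α := map_continuous α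
  -- multiplication by elements of `α A`
  have hA : ∀ x, (∀ s ∈ S, x * s = 0) → ∀ a, ∀ s ∈ S, x * α a * s = 0 := by
    intro x hx a s hs
    have hcl : IsClosed {b : A | x * α b * s = 0} := isClosed_eq (by fun_prop) continuous_const
    have hsub : (Submodule.span ℂ {n : A | IsNormalizer D n} : Set A) ⊆
        {b : A | x * α b * s = 0} := by
      intro b hb
      induction hb using Submodule.span_induction with
      | mem n hn =>
        apply rie_self_zero
        obtain ⟨d, hd, rfl⟩ := hs
        have := hx (α (n * (d * star d) * star n)) ⟨_,
          ⟨hJ.mul_right _ (hJ.mul_left _ trivial _ (hJ.mul_right _ hd.1 _ trivial)) _ trivial,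
          hn.1 _ (hD.inclusion.mul_mem _ hd.2 _ (hD.inclusion.star_mem _ hd.2))⟩, rfl⟩
        have e : x * α n * α d * star (x * α n * α d)
            = x * α (n * (d * star d) * star n) * star x := by
          simp [mul_assoc, map_star]
        rw [e, this, zero_mul]
      | zero => simp
      | add u v _ _ hu hv =>
        simp only [Set.mem_setOf_eq] at hu hv ⊢
        rw [map_add, mul_add, add_mul, hu, hv, add_zero]
      | smul c u _ hu =>
        simp only [Set.mem_setOf_eq] at hu ⊢
        rw [map_smul, mul_smul_comm, smul_mul_assoc, hu, smul_zero]
    exact hcl.closure_subset_iff.2 hsub (hD.regular a)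
  have hDm : ∀ x, (∀ s ∈ S, x * s = 0) → ∀ d ∈ D₁, ∀ s ∈ S, x * d * s = 0 := by
    intro x hx d hd s hs
    rw [mul_assoc, hab d hd s (hSD hs), ← mul_assoc, hx s hs, zero_mul]
  refine ⟨hSs, ?_⟩
  have hgen : ∀ b ∈ (NonUnitalStarAlgebra.adjoin ℂ (Set.range ⇑α ∪ E '' Set.range ⇑α) : Set A₁),
      (∀ x, (∀ s ∈ S, x * s = 0) → ∀ s ∈ S, x * b * s = 0) ∧
      (∀ x, (∀ s ∈ S, x * s = 0) → ∀ s ∈ S, x * star b * s = 0) := by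
    intro b hb
    induction hb using NonUnitalStarAlgebra.adjoin_induction with
    | mem b hb =>
      rcases hb with ⟨a, rfl⟩ | ⟨_, ⟨a, rfl⟩, rfl⟩
      · refine ⟨fun x hx => hA x hx a, fun x hx => ?_⟩
        rw [← map_star]; exact hA x hx (star a)
      · have hm := henv.cartan.condExp.mem (α a)
        exact ⟨fun x hx => hDm x hx _ hm, fun x hx => hDm x hx _ (hI.star_mem _ hm)⟩
    | add u v _ _ hu hv =>
      refine ⟨fun x hx s hs => ?_, fun x hx s hs => ?_⟩
      · rw [mul_add, add_mul, hu.1 x hx s hs, hv.1 x hx s hs, add_zero]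
      · rw [star_add, mul_add, add_mul, hu.2 x hx s hs, hv.2 x hx s hs, add_zero]
    | zero => simp
    | mul u v _ _ hu hv =>
      refine ⟨fun x hx s hs => ?_, fun x hx s hs => ?_⟩
      · rw [← mul_assoc]; exact hv.1 _ (hu.1 x hx) s hs
      · rw [star_mul, ← mul_assoc]; exact hu.2 _ (hv.2 x hx) s hs
    | smul c u _ hu =>
      refine ⟨fun x hx s hs => ?_, fun x hx s hs => ?_⟩
      · rw [mul_smul_comm, smul_mul_assoc, hu.1 x hx s hs, smul_zero]
      · rw [star_smul, mul_smul_comm, smul_mul_assoc, hu.2 x hx s hs, smul_zero]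
    | star u _ hu => exact ⟨hu.2, by simpa using hu.1⟩
  intro x hx b s hs
  have hcl : IsClosed {b : A₁ | x * b * s = 0} := isClosed_eq (by fun_prop) continuous_const
  have hb : b ∈ GeneratedCStar (Set.range ⇑α ∪ E '' Set.range ⇑α) := by
    rw [henv.generates]; trivial
  exact hcl.closure_subset_iff.2 (fun b hb => (hgen b hb).1 x hx s hs) hb

/-- Pulling back the annihilator. -/
theorem rie_pull (D : Set A) (D₁ : Set A₁) (α : A →⋆ₙₐ[ℂ] A₁) (E : A₁ → A₁)
    (hD : IsPseudoCartan D) (henv : IsCartanEnvelope D D₁ α E) (J : Set A)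
    (hJ : IsClosedIdealOf Set.univ J) (hJs : ∀ s ∈ J, star s ∈ J) :
    ⇑α ⁻¹' (Ann Set.univ (⇑α '' (J ∩ D))) = Ann Set.univ J := by
  rw [← rie_pseudo D hD J hJ hJs]
  ext a
  have hinj : ∀ b, α b = 0 ↔ b = 0 := fun b => map_eq_zero_iff α henv.injective
  constructor
  · intro h
    refine ⟨trivial, fun k hk => ?_⟩
    have := h.2 (α k) ⟨k, hk, rfl⟩
    rw [← map_mul, ← map_mul, hinj, hinj] at this
    exact this
  · intro h
    refine ⟨trivial, ?_⟩
    rintro _ ⟨k, hk, rfl⟩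
    have := h.2 k hk
    rw [← map_mul, ← map_mul, hinj, hinj]
    exact this

/-- The preimage of a regular ideal. -/
theorem rie_pre (D : Set A) (D₁ : Set A₁) (α : A →⋆ₙₐ[ℂ] A₁) (E : A₁ → A₁)
    (hD : IsPseudoCartan D) (henv : IsCartanEnvelope D D₁ α E) (J₁ : Set A₁)
    (hJ₁ : IsRegularIdealOf Set.univ J₁) :
    IsClosedIdealOf Set.univ (⇑α ⁻¹' J₁) ∧ (∀ s ∈ ⇑α ⁻¹' J₁, star s ∈ ⇑α ⁻¹' J₁) ∧
      Ann Set.univ (⇑α '' (⇑α ⁻¹' J₁ ∩ D)) = Ann Set.univ J₁ := by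
  have hI := henv.cartan.regularInclusion.1
  have hab := henv.cartan.abelian
  have hα : Continuous α := map_continuous α
  have hJs := rie_regular_star hJ₁
  have hid : IsClosedIdealOf Set.univ (⇑α ⁻¹' J₁) :=
    { subset := Set.subset_univ _
      zero_mem := by simpa using hJ₁.1.zero_mem
      add_mem := fun x hx y hy => by
        simpa using hJ₁.1.add_mem _ hx _ hy
      smul_mem := fun c x hx => by simpa using hJ₁.1.smul_mem c _ hx
      mul_left := fun c _ x hx => by simpa using hJ₁.1.mul_left (α c) trivial _ hx
      mul_right := fun x hx c _ => by simpa using hJ₁.1.mul_right _ hx (α c) trivial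
      isClosed := hJ₁.1.isClosed.preimage hα }
  have hst : ∀ s ∈ ⇑α ⁻¹' J₁, star s ∈ ⇑α ⁻¹' J₁ := by
    intro s hs
    simpa [map_star] using hJs _ hs
  refine ⟨hid, hst, ?_⟩
  have hgood := rie_good_image D D₁ α E hD henv _ hid hst
  set S := ⇑α '' (⇑α ⁻¹' J₁ ∩ D) with hSdef
  have hSD : S ⊆ D₁ := by
    rintro _ ⟨d, hd, rfl⟩; exact henv.maps d hd.2
  have hSJ : S ⊆ J₁ := by
    rintro _ ⟨d, hd, rfl⟩; exact hd.1
  refine Set.Subset.antisymm ?_ (rie_ann_anti _ hSJ)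
  rw [← rie_cartan_ann D₁ E henv.cartan J₁ hJ₁]
  have hK := rie_good_inter D₁ hI henv.cartan.regularInclusion.2 J₁ hJ₁.1 hJs
  intro x hx
  refine (hK.mem x).2 (rie_E_lemma D₁ E henv.cartan S _ hSD Set.inter_subset_right ?_ x
    ((hgood.mem x).1 hx))
  intro e heD he t ht
  have hid2 := hgood.ideal
  have hW : IsClosedIdealOf D₁ (J₁ ∩ D₁ ∩ Ann Set.univ S) :=
    { subset := fun _ h => h.1.2
      zero_mem := ⟨⟨hJ₁.1.zero_mem, hI.zero_mem⟩, hid2.zero_mem⟩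
      add_mem := fun x hx y hy => ⟨⟨hJ₁.1.add_mem x hx.1.1 y hy.1.1, hI.add_mem x hx.1.2 y hy.1.2⟩,
        hid2.add_mem x hx.2 y hy.2⟩
      smul_mem := fun c x hx => ⟨⟨hJ₁.1.smul_mem c x hx.1.1, hI.smul_mem c x hx.1.2⟩,
        hid2.smul_mem c x hx.2⟩
      mul_left := fun c hc x hx => ⟨⟨hJ₁.1.mul_left c trivial x hx.1.1, hI.mul_mem c hc x hx.1.2⟩,
        hid2.mul_left c trivial x hx.2⟩
      mul_right := fun x hx c hc => ⟨⟨hJ₁.1.mul_right x hx.1.1 c trivial,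
        hI.mul_mem x hx.1.2 c hc⟩, hid2.mul_right x hx.2 c trivial⟩
      isClosed := (hJ₁.1.isClosed.inter hI.isClosed).inter hid2.isClosed }
  by_contra hne
  obtain ⟨w, ⟨hw, ⟨d, hd, hdw⟩⟩, hw0⟩ := henv.iip _ hW ⟨e * t,
    ⟨⟨hJ₁.1.mul_left e trivial t ht.1, hI.mul_mem e heD t ht.2⟩,
      hid2.mul_right e ((hgood.mem e).2 he) t trivial⟩, hne⟩
  apply hw0
  apply rie_self_zero
  refine (hgood.mem w).1 hw.2 _ (hgood.star_mem w ⟨d, ⟨?_, hd⟩, hdw⟩)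
  rw [Set.mem_preimage, hdw]
  exact hw.1.1

end RieMain

/-- Let `(A,D)` be a pseudo-Cartan inclusion with Cartan envelope
`(A₁, D₁, α)`.  Then `J ↦ ((α(J ∩ D))^{⊥⊥_{D₁}})^{⊥⊥_{A₁}}` is an inclusion-preserving
bijection from the regular ideals of `A` onto the regular ideals of `A₁`. -/
theorem regular_ideal_lattice_iso_envelope
    {A : Type*} [NonUnitalCStarAlgebra A] [PartialOrder A] [StarOrderedRing A]
    {A₁ : Type*} [NonUnitalCStarAlgebra A₁] [PartialOrder A₁] [StarOrderedRing A₁]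
    (D : Set A) (D₁ : Set A₁) (α : A →⋆ₙₐ[ℂ] A₁) (E : A₁ → A₁)
    (hD : IsPseudoCartan D) (henv : IsCartanEnvelope D D₁ α E) :
    Set.BijOn
      (fun J => Ann (Set.univ : Set A₁) (Ann (Set.univ : Set A₁)
        (Ann D₁ (Ann D₁ (⇑α '' (J ∩ D))))))
      {J : Set A | IsRegularIdealOf (Set.univ : Set A) J}
      {J₁ : Set A₁ | IsRegularIdealOf (Set.univ : Set A₁) J₁} ∧
    (∀ J J' : Set A, IsRegularIdealOf (Set.univ : Set A) J →
      IsRegularIdealOf (Set.univ : Set A) J' → J ⊆ J' →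
      Ann (Set.univ : Set A₁) (Ann (Set.univ : Set A₁)
          (Ann D₁ (Ann D₁ (⇑α '' (J ∩ D))))) ⊆
        Ann (Set.univ : Set A₁) (Ann (Set.univ : Set A₁)
          (Ann D₁ (Ann D₁ (⇑α '' (J' ∩ D)))))) := by
  have hmap : ∀ J : Set A, IsRegularIdealOf (Set.univ : Set A) J →
      Ann (Set.univ : Set A₁) (Ann D₁ (Ann D₁ (⇑α '' (J ∩ D))))
        = Ann Set.univ (⇑α '' (J ∩ D)) := by
    intro J hJ
    refine rie_ann_annD D₁ E henv.cartan _ ?_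
      (rie_good_image D D₁ α E hD henv J hJ.1 (rie_regular_star hJ)).star_mem
    rintro _ ⟨d, hd, rfl⟩
    exact henv.maps d hd.2
  refine ⟨⟨?_, ?_, ?_⟩, ?_⟩
  · intro J hJ
    have hJ' : IsRegularIdealOf (Set.univ : Set A) J := hJ
    change IsRegularIdealOf _ (Ann _ (Ann _ (Ann D₁ (Ann D₁ (⇑α '' (J ∩ D))))))
    rw [hmap J hJ']
    exact (rie_good_image D D₁ α E hD henv J hJ'.1 (rie_regular_star hJ')).ann.regular
  · have key : ∀ J : Set A, IsRegularIdealOf (Set.univ : Set A) J →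
        Ann Set.univ (⇑α ⁻¹' (Ann Set.univ (Ann (Set.univ : Set A₁) (Ann (Set.univ : Set A₁)
          (Ann D₁ (Ann D₁ (⇑α '' (J ∩ D)))))))) = J := by
      intro J hJ
      rw [hmap J hJ, rie_ann3, rie_pull D D₁ α E hD henv J hJ.1 (rie_regular_star hJ), hJ.2]
    intro J hJ J' hJ' heq
    rw [← key J hJ, ← key J' hJ']
    exact congrArg (fun X => Ann Set.univ (⇑α ⁻¹' (Ann Set.univ X))) heq
  · intro J₁ hJ₁
    have hJ₁' : IsRegularIdealOf (Set.univ : Set A₁) J₁ := hJ₁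
    have hL₁ := (rie_regular_good hJ₁').regular
    obtain ⟨a1, a2, a3⟩ := rie_pre D D₁ α E hD henv J₁ hJ₁'
    obtain ⟨b1, b2, b3⟩ := rie_pre D D₁ α E hD henv _ hL₁
    have c1 := rie_pull D D₁ α E hD henv _ a1 a2
    have c2 := rie_pull D D₁ α E hD henv _ b1 b2
    rw [a3] at c1
    rw [b3, hJ₁'.2] at c2
    have hreg : IsRegularIdealOf Set.univ (⇑α ⁻¹' J₁) := ⟨a1, by rw [← c1, ← c2]⟩
    refine ⟨⇑α ⁻¹' J₁, hreg, ?_⟩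
    change Ann _ (Ann _ (Ann D₁ (Ann D₁ (⇑α '' (⇑α ⁻¹' J₁ ∩ D))))) = J₁
    rw [hmap _ hreg, a3, hJ₁'.2]
  · intro J J' _ _ hsub
    exact rie_ann_anti _ (rie_ann_anti _ (rie_ann_anti _ (rie_ann_anti _
      (Set.image_mono (Set.inter_subset_inter_left _ hsub)))))
end

section
/- Let (A,B) be a regular inclusion of C*-algebras having the ideal intersection property, let J be a regular ideal of A, and let q : A → A/J be the quotient map onto the quotient C*-algebra. Then the inclusion (A/J, q(B)) has the ideal intersection property: every nonzero closed two-sided ideal I of A/J satisfies I ∩ q(B) ≠ {0}. -/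
/-- Let `(A,B)` be a regular inclusion of C*-algebras with the ideal
intersection property, let `J` be a regular ideal of `A`, and let `q : A → A/J` be the
quotient map (encoded as a surjective *-homomorphism onto a C*-algebra `Q` with kernel `J`).
Then the inclusion `(A/J, q(B))` has the ideal intersection property. -/
theorem quotient_ideal_intersection_property
    {A : Type*} [NonUnitalCStarAlgebra A] [PartialOrder A] [StarOrderedRing A]
    {Q : Type*} [NonUnitalCStarAlgebra Q] [PartialOrder Q] [StarOrderedRing Q]
    (B : Set A) (hB : IsRegularInclusion B)
    (hiip : IdealIntersectionProperty (Set.univ : Set A) B)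
    (J : Set A) (hJ : IsRegularIdealOf (Set.univ : Set A) J)
    (q : A →⋆ₙₐ[ℂ] Q) (hq : Function.Surjective q) (hker : ∀ a : A, q a = 0 ↔ a ∈ J) :
    IdealIntersectionProperty (Set.univ : Set Q) (⇑q '' B) := by
  intro I hI hne
  obtain ⟨x, hxI, hx0⟩ := hne
  obtain ⟨a, rfl⟩ := hq x
  obtain ⟨hJi, hJr⟩ := hJ
  have hqc : Continuous q := map_continuous q
  have hAclosed : IsClosed (Ann (Set.univ : Set A) J) := by
    have : Ann (Set.univ : Set A) J = ⋂ x ∈ J, ({c | c * x = 0} ∩ {c | x * c = 0}) := by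
      ext c
      simp [Ann]
    rw [this]
    refine isClosed_biInter fun x _ => IsClosed.inter ?_ ?_
    · exact isClosed_eq (by fun_prop) (by fun_prop)
    · exact isClosed_eq (by fun_prop) (by fun_prop)
  have hAl : ∀ c : A, ∀ y ∈ Ann (Set.univ : Set A) J, c * y ∈ Ann (Set.univ : Set A) J := by
    intro c y hy
    refine ⟨trivial, fun z hz => ⟨?_, ?_⟩⟩
    · rw [mul_assoc, (hy.2 z hz).1, mul_zero]
    · rw [← mul_assoc, (hy.2 _ (hJi.mul_right z hz c trivial)).2]
  have hAr : ∀ c : A, ∀ y ∈ Ann (Set.univ : Set A) J, y * c ∈ Ann (Set.univ : Set A) J := by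
    intro c y hy
    refine ⟨trivial, fun z hz => ⟨?_, ?_⟩⟩
    · rw [mul_assoc, (hy.2 _ (hJi.mul_left c trivial z hz)).1]
    · rw [← mul_assoc, (hy.2 z hz).2, zero_mul]
  have hKl : ∀ c y : A, q y ∈ I → q (c * y) ∈ I := fun c y hy => by
    rw [map_mul]; exact hI.mul_left _ trivial _ hy
  have hKr : ∀ c y : A, q y ∈ I → q (y * c) ∈ I := fun c y hy => by
    rw [map_mul]; exact hI.mul_right _ hy _ trivial
  have hL : IsClosedIdealOf (Set.univ : Set A) (q ⁻¹' I ∩ Ann Set.univ J) :=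
    { subset := fun _ _ => trivial
      zero_mem := ⟨by simpa using hI.zero_mem, trivial, by simp⟩
      add_mem := by
        rintro y ⟨hy1, hy2⟩ z ⟨hz1, hz2⟩
        refine ⟨?_, trivial, fun w hw => ⟨?_, ?_⟩⟩
        · rw [Set.mem_preimage, map_add]; exact hI.add_mem _ hy1 _ hz1
        · rw [add_mul, (hy2.2 w hw).1, (hz2.2 w hw).1, add_zero]
        · rw [mul_add, (hy2.2 w hw).2, (hz2.2 w hw).2, add_zero]
      smul_mem := by
        rintro c y ⟨hy1, hy2⟩
        refine ⟨?_, trivial, fun w hw => ⟨?_, ?_⟩⟩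
        · rw [Set.mem_preimage, map_smul]; exact hI.smul_mem _ _ hy1
        · rw [smul_mul_assoc, (hy2.2 w hw).1, smul_zero]
        · rw [mul_smul_comm, (hy2.2 w hw).2, smul_zero]
      mul_left := fun c _ y hy => ⟨hKl c y hy.1, hAl c y hy.2⟩
      mul_right := fun y hy c _ => ⟨hKr c y hy.1, hAr c y hy.2⟩
      isClosed := (hI.isClosed.preimage hqc).inter hAclosed }
  have hLne : ∃ y ∈ q ⁻¹' I ∩ Ann Set.univ J, y ≠ 0 := by
    by_contra! h
    apply hx0
    rw [hker, ← hJr]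
    exact ⟨trivial, fun c hc => ⟨h _ ⟨hKr c a hxI, hAl a c hc⟩, h _ ⟨hKl c a hxI, hAr a c hc⟩⟩⟩
  obtain ⟨b, ⟨⟨hbI, hbA⟩, hbB⟩, hb0⟩ := hiip _ hL hLne
  refine ⟨q b, ⟨hbI, b, hbB, rfl⟩, fun h => hb0 ?_⟩
  have h1 : b * (star b * b) = 0 := (hbA.2 _ (hJi.mul_left (star b) trivial b ((hker b).1 h))).1
  have h2 : star (star b * b) * (star b * b) = 0 := by
    rw [star_mul, star_star, mul_assoc, h1, mul_zero]
  exact CStarRing.star_mul_self_eq_zero_iff b |>.1 (CStarRing.star_mul_self_eq_zero_iff _ |>.1 h2)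
end

section
/- Let (A,D) be a pseudo-Cartan inclusion of C*-algebras, let J be a regular ideal of A, and let q : A → A/J be the quotient map. Then (A/J, q(D)) is a pseudo-Cartan inclusion: it is a regular inclusion, q(D) is abelian, the relative commutant q(D)^c of q(D) in A/J is abelian, and both inclusions (q(D)^c, q(D)) and (A/J, q(D)^c) have the ideal intersection property. -/
lemma qpc_cont {S Q : Type*} [NonUnitalCStarAlgebra S] [NonUnitalCStarAlgebra Q]
    (φ : S →⋆ₙₐ[ℂ] Q) : Continuous φ :=
  AddMonoidHomClass.continuous_of_bound φ 1 fun x => by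
    simpa using NonUnitalStarAlgHom.norm_apply_le φ x

/-- Lifting with norm control for star homomorphisms, self-adjoint case. -/
lemma qpc_lift_sa {S Q : Type*} [NonUnitalCStarAlgebra S] [NonUnitalCStarAlgebra Q]
    (φ : S →⋆ₙₐ[ℂ] Q) (d : S) (hd : IsSelfAdjoint d) :
    ∃ d' : S, φ d' = φ d ∧ ‖d'‖ ≤ ‖φ d‖ := by
  set r := ‖φ d‖ with hr
  have hr0 : 0 ≤ r := norm_nonneg _
  let f : ℝ → ℝ := fun t => max (-r) (min r t)
  have hf : Continuous f := by fun_prop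
  have hf0 : f 0 = 0 := by
    simp only [f]
    rw [min_eq_right hr0, max_eq_right (by linarith)]
  have hqd : IsSelfAdjoint (φ d) := hd.map φ
  refine ⟨cfcₙ f d, ?_, ?_⟩
  · have h1 : φ (cfcₙ f d) = cfcₙ f (φ d) :=
      NonUnitalStarAlgHomClass.map_cfcₙ (S := ℂ) φ f d hf.continuousOn hf0
        (qpc_cont φ) hd hqd
    rw [h1]
    have h2 : cfcₙ f (φ d) = cfcₙ (fun t : ℝ => t) (φ d) := by
      apply cfcₙ_congr
      intro t ht
      have ht' : |t| ≤ r := by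
        have := NonUnitalIsometricContinuousFunctionalCalculus.norm_quasispectrum_le (φ d) ht hqd
        simpa using this
      obtain ⟨h3, h4⟩ := abs_le.mp ht'
      simp only [f]
      rw [min_eq_right h4, max_eq_right h3]
    rw [h2]
    exact cfcₙ_id' ℝ (φ d)
  · apply norm_cfcₙ_le
    intro t _
    rw [Real.norm_eq_abs, abs_le]
    simp only [f]
    exact ⟨le_max_left _ _, max_le (by linarith) (min_le_left _ _)⟩

lemma qpc_lift {S Q : Type*} [NonUnitalCStarAlgebra S] [NonUnitalCStarAlgebra Q]
    (φ : S →⋆ₙₐ[ℂ] Q) (d : S) :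
    ∃ d' : S, φ d' = φ d ∧ ‖d'‖ ≤ 2 * ‖φ d‖ := by
  obtain ⟨a, ha, ha'⟩ := qpc_lift_sa φ (realPart d : S) (realPart d).2
  obtain ⟨b, hb, hb'⟩ := qpc_lift_sa φ (imaginaryPart d : S) (imaginaryPart d).2
  have e := realPart_add_I_smul_imaginaryPart d
  have h1 : φ (realPart d : S) = (realPart (φ d) : Q) := by
    exact map_realPart φ d
  have h2 : φ (imaginaryPart d : S) = (imaginaryPart (φ d) : Q) := by
    exact map_imaginaryPart φ d
  refine ⟨a + Complex.I • b, ?_, ?_⟩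
  · rw [map_add, map_smul, ha, hb, ← map_smul, ← map_add, e]
  · have h3 : ‖(realPart (φ d) : Q)‖ ≤ ‖φ d‖ := realPart.norm_le (φ d)
    have h4 : ‖(imaginaryPart (φ d) : Q)‖ ≤ ‖φ d‖ := imaginaryPart.norm_le (φ d)
    rw [h1] at ha'
    rw [h2] at hb'
    have h5 := norm_add_le a (Complex.I • b)
    have h6 : ‖Complex.I • b‖ = ‖b‖ := by rw [norm_smul]; simp
    linarith

lemma qpc_closed_range {S Q : Type*} [NonUnitalCStarAlgebra S] [NonUnitalCStarAlgebra Q]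
    (φ : S →⋆ₙₐ[ℂ] Q) : IsClosed (Set.range φ) := by
  let f : NormedAddGroupHom S Q :=
    { toFun := φ, map_add' := map_add φ,
      bound' := ⟨1, fun v => by simpa using NonUnitalStarAlgHom.norm_apply_le φ v⟩ }
  have h : f.SurjectiveOnWith f.range 2 := by
    rintro _ ⟨d, rfl⟩
    obtain ⟨d', h1, h2⟩ := qpc_lift φ d
    exact ⟨d', h1, h2⟩
  have h' := controlled_closure_of_complete (by norm_num) (one_pos) h
  apply isClosed_of_closure_subset
  intro y hy
  have : y ∈ f.range.topologicalClosure := hy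
  obtain ⟨d, hd, -⟩ := h' y this
  exact ⟨d, hd⟩

/-- The image of a closed star-subalgebra under a star homomorphism is closed. -/
lemma qpc_closed_image {A Q : Type*} [NonUnitalCStarAlgebra A] [PartialOrder A]
    [StarOrderedRing A] [NonUnitalCStarAlgebra Q]
    (D : Set A) (hD : IsInclusion D) (q : A →⋆ₙₐ[ℂ] Q) : IsClosed (q '' D) := by
  let S : NonUnitalStarSubalgebra ℂ A :=
    { carrier := D
      zero_mem' := hD.zero_mem
      add_mem' := fun {x y} hx hy => hD.add_mem x hx y hy
      mul_mem' := fun {x y} hx hy => hD.mul_mem x hx y hy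
      smul_mem' := fun c x hx => hD.smul_mem c x hx
      star_mem' := fun {x} hx => hD.star_mem x hx }
  have : IsClosed (S : Set A) := hD.isClosed
  have h := qpc_closed_range (q.comp (NonUnitalStarSubalgebraClass.subtype S))
  convert h using 1
  ext y
  constructor
  · rintro ⟨d, hd, rfl⟩
    exact ⟨⟨d, hd⟩, rfl⟩
  · rintro ⟨⟨d, hd⟩, rfl⟩
    exact ⟨d, hd, rfl⟩

/-- Combined ideal intersection property of `(A, D)`. -/
lemma qpc_iip {A : Type*} [NonUnitalCStarAlgebra A] [PartialOrder A] [StarOrderedRing A]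
    (D : Set A) (hD : IsPseudoCartan D) : IdealIntersectionProperty (Set.univ : Set A) D := by
  intro I hI hne
  obtain ⟨x, ⟨hxI, hxc⟩, hx0⟩ := hD.iip_A I hI hne
  have hclosed : IsClosed (RelComm D) := by
    have : RelComm D = ⋂ d ∈ D, {a : A | a * d = d * a} := by
      ext a; simp [RelComm]
    rw [this]
    exact isClosed_biInter fun d _ => isClosed_eq (by fun_prop) (by fun_prop)
  have hid : IsClosedIdealOf (RelComm D) (I ∩ RelComm D) :=
    { subset := fun _ h => h.2
      zero_mem := ⟨hI.zero_mem, fun d _ => by simp⟩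
      add_mem := fun x hx y hy => ⟨hI.add_mem x hx.1 y hy.1, fun d hd => by
        rw [add_mul, mul_add, hx.2 d hd, hy.2 d hd]⟩
      smul_mem := fun c x hx => ⟨hI.smul_mem c x hx.1, fun d hd => by
        rw [smul_mul_assoc, mul_smul_comm, hx.2 d hd]⟩
      mul_left := fun c hc x hx => ⟨hI.mul_left c trivial x hx.1, fun d hd => by
        rw [mul_assoc, hx.2 d hd, ← mul_assoc, hc d hd, mul_assoc]⟩
      mul_right := fun x hx c hc => ⟨hI.mul_right x hx.1 c trivial, fun d hd => by
        rw [mul_assoc, hc d hd, ← mul_assoc, hx.2 d hd, mul_assoc]⟩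
      isClosed := hI.isClosed.inter hclosed }
  obtain ⟨y, hy, hy0⟩ := hD.iip_relComm _ hid ⟨x, ⟨hxI, hxc⟩, hx0⟩
  exact ⟨y, ⟨hy.1.1, hy.2⟩, hy0⟩

/-- If `K` is a closed ideal and `c` kills `K ∩ D`, then `c` kills `K`. -/
lemma qpc_key {A : Type*} [NonUnitalCStarAlgebra A] [PartialOrder A] [StarOrderedRing A]
    (D : Set A) (hD : IsPseudoCartan D) (K : Set A)
    (hK : IsClosedIdealOf (Set.univ : Set A) K)
    (c : A) (hc : ∀ d ∈ K, d ∈ D → c * d = 0) :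
    ∀ k ∈ K, c * k = 0 ∧ k * c = 0 := by
  have h1 : ∀ d ∈ K, d ∈ D → ∀ a : A, c * a * d = 0 := by
    intro d hdK hdD
    have hcl : IsClosed {a : A | c * a * d = 0} := isClosed_eq (by fun_prop) (by fun_prop)
    have hsub : (↑(Submodule.span ℂ {n : A | IsNormalizer D n}) : Set A)
        ⊆ {a : A | c * a * d = 0} := by
      intro a ha
      induction ha using Submodule.span_induction with
      | mem n hn =>
        have h2 : c * (n * (d * star d) * star n) = 0 := by
          apply hc
          · exact hK.mul_right _ (hK.mul_left _ trivial _ (hK.mul_right _ hdK _ trivial)) _ trivial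
          · exact hn.1 _ (hD.inclusion.mul_mem _ hdD _ (hD.inclusion.star_mem _ hdD))
        have h3 : (c * n * d) * star (c * n * d) = 0 := by
          have : (c * n * d) * star (c * n * d) = c * (n * (d * star d) * star n) * star c := by
            simp only [star_mul, mul_assoc]
          rw [this, h2, zero_mul]
        exact CStarRing.mul_star_self_eq_zero_iff _ |>.mp h3
      | zero => simp
      | add x y _ _ hx hy =>
        simp only [Set.mem_ofPred_eq] at *
        rw [mul_add, add_mul, hx, hy, add_zero]
      | smul r x _ hx =>
        simp only [Set.mem_ofPred_eq] at *
        rw [mul_smul_comm, smul_mul_assoc, hx, smul_zero]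
    intro a
    have := hcl.closure_subset_iff.mpr hsub (hD.regular a)
    exact this
  let M : Set A := {m : A | m ∈ K ∧ ∀ d ∈ K, d ∈ D → ∀ a : A, m * a * d = 0}
  have hM : IsClosedIdealOf (Set.univ : Set A) M :=
    { subset := fun _ _ => trivial
      zero_mem := ⟨hK.zero_mem, fun d _ _ a => by simp⟩
      add_mem := fun x hx y hy => ⟨hK.add_mem x hx.1 y hy.1, fun d h h' a => by
        rw [add_mul, add_mul, hx.2 d h h' a, hy.2 d h h' a, add_zero]⟩
      smul_mem := fun r x hx => ⟨hK.smul_mem r x hx.1, fun d h h' a => by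
        rw [smul_mul_assoc, smul_mul_assoc, hx.2 d h h' a, smul_zero]⟩
      mul_left := fun b _ x hx => ⟨hK.mul_left b trivial x hx.1, fun d h h' a => by
        rw [mul_assoc b x a, mul_assoc b, hx.2 d h h' a, mul_zero]⟩
      mul_right := fun x hx b _ => ⟨hK.mul_right x hx.1 b trivial, fun d h h' a => by
        rw [mul_assoc x b a, hx.2 d h h' _]⟩
      isClosed := by
        have : M = K ∩ ⋂ d ∈ K, ⋂ (_ : d ∈ D), ⋂ a : A, {m : A | m * a * d = 0} := by
          ext m; simp [M]
        rw [this]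
        refine hK.isClosed.inter (isClosed_biInter fun d _ => isClosed_iInter fun _ =>
          isClosed_iInter fun a => isClosed_eq (by fun_prop) (by fun_prop)) }
  have hM0 : ∀ m ∈ M, m = 0 := by
    intro m hm
    by_contra hne
    obtain ⟨x, ⟨hxM, hxD⟩, hx0⟩ := qpc_iip D hD M hM ⟨m, hm, hne⟩
    apply hx0
    have h2 : x * star x * x = 0 := hxM.2 x hxM.1 hxD (star x)
    have h3 : (x * star x) * star (x * star x) = 0 := by
      rw [star_mul, star_star, ← mul_assoc, h2, zero_mul]
    have h4 := CStarRing.mul_star_self_eq_zero_iff _ |>.mp h3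
    exact CStarRing.mul_star_self_eq_zero_iff _ |>.mp h4
  intro k hk
  constructor
  · apply hM0
    exact ⟨hK.mul_left _ trivial _ hk, fun d h h' a => by rw [mul_assoc c k a]; exact h1 d h h' _⟩
  · apply hM0
    exact ⟨hK.mul_right _ hk _ trivial, fun d h h' a => by
      rw [mul_assoc k c a, mul_assoc k, h1 d h h' a, mul_zero]⟩

/-- Let `(A,D)` be a pseudo-Cartan inclusion, let `J` be a regular ideal
of `A`, and let `q : A → A/J` be the quotient map (encoded as a surjective *-homomorphism
onto a C*-algebra `Q` with kernel `J`).  Then `(A/J, q(D))` is a pseudo-Cartan inclusion. -/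
theorem quotient_pseudoCartan
    {A : Type*} [NonUnitalCStarAlgebra A] [PartialOrder A] [StarOrderedRing A]
    {Q : Type*} [NonUnitalCStarAlgebra Q] [PartialOrder Q] [StarOrderedRing Q]
    (D : Set A) (hD : IsPseudoCartan D)
    (J : Set A) (hJ : IsRegularIdealOf (Set.univ : Set A) J)
    (q : A →⋆ₙₐ[ℂ] Q) (hq : Function.Surjective q) (hker : ∀ a : A, q a = 0 ↔ a ∈ J) :
    IsPseudoCartan (⇑q '' D) := by
  have hqc : Continuous q := qpc_cont q
  have hJs : ∀ x ∈ J, star x ∈ J := by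
    intro x hx
    rw [← hker] at hx ⊢
    rw [map_star, hx, star_zero]
  have hJi := hJ.1
  -- the annihilator
  obtain ⟨K, hKdef⟩ : ∃ K : Set A, K = Ann Set.univ J := ⟨_, rfl⟩
  have hmemK : ∀ k, k ∈ K ↔ ∀ x ∈ J, k * x = 0 ∧ x * k = 0 := by
    intro k; rw [hKdef]; simp [Ann]
  have hmemJ : ∀ x, x ∈ J ↔ ∀ k ∈ K, x * k = 0 ∧ k * x = 0 := by
    intro x
    rw [← hJ.2, ← hKdef]; simp [Ann]
  have hK : IsClosedIdealOf (Set.univ : Set A) K :=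
    { subset := fun _ _ => trivial
      zero_mem := by rw [hmemK]; intro x _; simp
      add_mem := fun x hx y hy => by
        rw [hmemK] at *
        intro z hz
        rw [add_mul, mul_add, (hx z hz).1, (hx z hz).2, (hy z hz).1, (hy z hz).2]
        simp
      smul_mem := fun c x hx => by
        rw [hmemK] at *
        intro z hz
        rw [smul_mul_assoc, mul_smul_comm, (hx z hz).1, (hx z hz).2]
        simp
      mul_left := fun b _ x hx => by
        rw [hmemK] at *
        intro z hz
        rw [mul_assoc, (hx z hz).1, ← mul_assoc, (hx _ (hJi.mul_right z hz b trivial)).2]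
        simp
      mul_right := fun x hx b _ => by
        rw [hmemK] at *
        intro z hz
        rw [mul_assoc x b z, (hx _ (hJi.mul_left b trivial z hz)).1, ← mul_assoc,
          (hx z hz).2]
        simp
      isClosed := by
        have : K = ⋂ x ∈ J, ({k : A | k * x = 0} ∩ {k : A | x * k = 0}) := by
          ext k; rw [hmemK]; simp
        rw [this]
        exact isClosed_biInter fun x _ =>
          (isClosed_eq (by fun_prop) (by fun_prop)).inter (isClosed_eq (by fun_prop) (by fun_prop)) }
  have hKs : ∀ k ∈ K, star k ∈ K := by
    intro k hk
    rw [hmemK] at *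
    intro x hx
    have h := hk _ (hJs x hx)
    constructor
    · have := congrArg star h.2
      simpa using this
    · have := congrArg star h.1
      simpa using this
  have hKJ : ∀ x ∈ K, q x = 0 → x = 0 := by
    intro x hx h0
    have h1 := ((hmemK x).mp hx _ (hJs x ((hker x).mp h0))).1
    exact CStarRing.mul_star_self_eq_zero_iff _ |>.mp h1
  have hkey : ∀ c : A, (∀ d ∈ K, d ∈ D → c * d = 0) → q c = 0 := by
    intro c hc
    rw [hker, hmemJ]
    exact qpc_key D hD K hK c hc
  -- elements of the relative commutant
  have hcomm : ∀ x : A, q x ∈ RelComm (q '' D) → ∀ d ∈ D, x * d - d * x ∈ J := by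
    intro x hx d hd
    rw [← hker, map_sub, map_mul, map_mul, hx _ ⟨d, hd, rfl⟩, sub_self]
  have hswap : ∀ x : A, q x ∈ RelComm (q '' D) → ∀ k ∈ K, k ∈ D → x * k = k * x := by
    intro x hx k hk hkD
    rw [← sub_eq_zero]
    apply hKJ
    · rw [sub_eq_add_neg, ← neg_one_smul ℂ]
      exact hK.add_mem _ (hK.mul_left _ trivial _ hk) _
        (hK.smul_mem _ _ (hK.mul_right _ hk _ trivial))
    · rw [hker]; exact hcomm x hx k hkD
  have hxk : ∀ x : A, q x ∈ RelComm (q '' D) → ∀ k ∈ K, k ∈ D → x * k ∈ RelComm D := by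
    intro x hx k hk hkD d hd
    have h1 := ((hmemK k).mp hk _ (hcomm x hx d hd)).2
    rw [sub_mul, sub_eq_zero] at h1
    rw [mul_assoc, hD.abelian k hkD d hd, ← mul_assoc, h1, mul_assoc]
  have hqrel : ∀ x ∈ RelComm D, q x ∈ RelComm (q '' D) := by
    rintro x hx _ ⟨d, hd, rfl⟩
    rw [← map_mul, ← map_mul, hx d hd]
  have hclosedRC : IsClosed (RelComm D) := by
    have : RelComm D = ⋂ d ∈ D, {a : A | a * d = d * a} := by
      ext a; simp [RelComm]
    rw [this]
    exact isClosed_biInter fun d _ => isClosed_eq (by fun_prop) (by fun_prop)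
  refine
    { inclusion :=
        { zero_mem := ⟨0, hD.inclusion.zero_mem, map_zero q⟩
          add_mem := ?_
          smul_mem := ?_
          mul_mem := ?_
          star_mem := ?_
          isClosed := qpc_closed_image D hD.inclusion q
          approxUnit := ?_ }
      regular := ?_
      abelian := ?_
      relCommAbelian := ?_
      iip_relComm := ?_
      iip_A := ?_ }
  · rintro _ ⟨x, hx, rfl⟩ _ ⟨y, hy, rfl⟩
    exact ⟨x + y, hD.inclusion.add_mem x hx y hy, map_add q x y⟩
  · rintro c _ ⟨x, hx, rfl⟩
    exact ⟨c • x, hD.inclusion.smul_mem c x hx, map_smul q c x⟩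
  · rintro _ ⟨x, hx, rfl⟩ _ ⟨y, hy, rfl⟩
    exact ⟨x * y, hD.inclusion.mul_mem x hx y hy, map_mul q x y⟩
  · rintro _ ⟨x, hx, rfl⟩
    exact ⟨star x, hD.inclusion.star_mem x hx, map_star q x⟩
  · intro s ε hε
    classical
    choose g hg using hq
    obtain ⟨e, heD, he0, he1, he⟩ := hD.inclusion.approxUnit (s.image g) ε hε
    refine ⟨q e, ⟨e, heD, rfl⟩, map_nonneg q he0,
      (NonUnitalStarAlgHom.norm_apply_le q e).trans he1, ?_⟩
    intro a ha
    have h1 := he (g a) (Finset.mem_image_of_mem g ha)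
    have h2 := NonUnitalStarAlgHom.norm_apply_le q (e * g a - g a)
    rw [map_sub, map_mul, hg] at h2
    exact h2.trans_lt h1
  · have h1 := hq.denseRange.dense_image hqc hD.regular
    refine h1.mono ?_
    rintro _ ⟨a, ha, rfl⟩
    induction ha using Submodule.span_induction with
    | mem n hn =>
      apply Submodule.subset_span
      constructor
      · rintro _ ⟨d, hd, rfl⟩
        exact ⟨_, hn.1 d hd, by rw [map_mul, map_mul, map_star]⟩
      · rintro _ ⟨d, hd, rfl⟩
        exact ⟨_, hn.2 d hd, by rw [map_mul, map_mul, map_star]⟩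
    | zero => rw [map_zero]; exact Submodule.zero_mem _
    | add x y _ _ hx hy => rw [map_add]; exact Submodule.add_mem _ hx hy
    | smul r x _ hx => rw [map_smul]; exact Submodule.smul_mem _ r hx
  · rintro _ ⟨x, hx, rfl⟩ _ ⟨y, hy, rfl⟩
    rw [← map_mul, ← map_mul, hD.abelian x hx y hy]
  · intro x' hx y' hy
    obtain ⟨x, rfl⟩ := hq x'
    obtain ⟨y, rfl⟩ := hq y'
    rw [← sub_eq_zero, ← map_mul, ← map_mul, ← map_sub]
    apply hkey
    intro k hk hkD
    -- first kill products of two elements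
    have hprod : ∀ l ∈ K, l ∈ D → (x * y - y * x) * k * l = 0 := by
      intro l hl hlD
      have h1 := hD.relCommAbelian _ (hxk x hx k hk hkD) _ (hxk y hy l hl hlD)
      have h2 : x * k * (y * l) = x * y * k * l := by
        rw [mul_assoc x k, ← mul_assoc k y l, ← hswap y hy k hk hkD]
        simp only [mul_assoc]
      have h3 : y * l * (x * k) = y * x * k * l := by
        rw [mul_assoc y l, ← mul_assoc l x k, ← hswap x hx l hl hlD]
        simp only [mul_assoc]
        rw [hD.abelian l hlD k hkD]
      rw [sub_mul, sub_mul, ← h2, ← h3, h1, sub_self]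
    exact hKJ _ (hK.mul_left _ trivial _ hk) (hkey _ hprod)
  · intro I hI hne
    obtain ⟨x', hxI, hx0⟩ := hne
    obtain ⟨x, rfl⟩ := hq x'
    have hxR := hI.subset hxI
    have hid : IsClosedIdealOf (RelComm D) {y : A | y ∈ RelComm D ∧ y ∈ K ∧ q y ∈ I} :=
      { subset := fun _ h => h.1
        zero_mem := ⟨fun d _ => by simp, hK.zero_mem, by rw [map_zero]; exact hI.zero_mem⟩
        add_mem := fun x hx y hy => ⟨fun d hd => by
          rw [add_mul, mul_add, hx.1 d hd, hy.1 d hd], hK.add_mem _ hx.2.1 _ hy.2.1, by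
          rw [map_add]; exact hI.add_mem _ hx.2.2 _ hy.2.2⟩
        smul_mem := fun c x hx => ⟨fun d hd => by
          rw [smul_mul_assoc, mul_smul_comm, hx.1 d hd], hK.smul_mem _ _ hx.2.1, by
          rw [map_smul]; exact hI.smul_mem _ _ hx.2.2⟩
        mul_left := fun c hc x hx => ⟨fun d hd => by
          rw [mul_assoc, hx.1 d hd, ← mul_assoc, hc d hd, mul_assoc],
          hK.mul_left _ trivial _ hx.2.1, by
          rw [map_mul]; exact hI.mul_left _ (hqrel c hc) _ hx.2.2⟩
        mul_right := fun x hx c hc => ⟨fun d hd => by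
          rw [mul_assoc, hc d hd, ← mul_assoc, hx.1 d hd, mul_assoc],
          hK.mul_right _ hx.2.1 _ trivial, by
          rw [map_mul]; exact hI.mul_right _ hx.2.2 _ (hqrel c hc)⟩
        isClosed := hclosedRC.inter (hK.isClosed.inter (hI.isClosed.preimage hqc)) }
    have hex : ∃ k ∈ K, k ∈ D ∧ x * k ≠ 0 := by
      by_contra hcon
      push Not at hcon
      exact hx0 (hkey x hcon)
    obtain ⟨k, hk, hkD, hne⟩ := hex
    have hqk : q k ∈ RelComm (q '' D) := hqrel k fun d hd => hD.abelian k hkD d hd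
    obtain ⟨y, ⟨hy, hyD⟩, hy0⟩ := hD.iip_relComm _ hid
      ⟨x * k, ⟨hxk x hxR k hk hkD, hK.mul_left _ trivial _ hk, by
        rw [map_mul]; exact hI.mul_right _ hxI _ hqk⟩, hne⟩
    exact ⟨q y, ⟨hy.2.2, y, hyD, rfl⟩, fun h => hy0 (hKJ y hy.2.1 h)⟩
  · intro I hI hne
    obtain ⟨x', hxI, hx0⟩ := hne
    obtain ⟨x, rfl⟩ := hq x'
    have hid : IsClosedIdealOf (Set.univ : Set A) {y : A | y ∈ K ∧ q y ∈ I} :=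
      { subset := fun _ _ => trivial
        zero_mem := ⟨hK.zero_mem, by rw [map_zero]; exact hI.zero_mem⟩
        add_mem := fun x hx y hy => ⟨hK.add_mem _ hx.1 _ hy.1, by
          rw [map_add]; exact hI.add_mem _ hx.2 _ hy.2⟩
        smul_mem := fun c x hx => ⟨hK.smul_mem _ _ hx.1, by
          rw [map_smul]; exact hI.smul_mem _ _ hx.2⟩
        mul_left := fun c _ x hx => ⟨hK.mul_left _ trivial _ hx.1, by
          rw [map_mul]; exact hI.mul_left _ trivial _ hx.2⟩
        mul_right := fun x hx c _ => ⟨hK.mul_right _ hx.1 _ trivial, by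
          rw [map_mul]; exact hI.mul_right _ hx.2 _ trivial⟩
        isClosed := hK.isClosed.inter (hI.isClosed.preimage hqc) }
    have hex : ∃ k ∈ K, k ∈ D ∧ x * k ≠ 0 := by
      by_contra hcon
      push Not at hcon
      exact hx0 (hkey x hcon)
    obtain ⟨k, hk, hkD, hne⟩ := hex
    obtain ⟨y, ⟨hy, hyR⟩, hy0⟩ := hD.iip_A _ hid
      ⟨x * k, ⟨hK.mul_left _ trivial _ hk, by
        rw [map_mul]; exact hI.mul_right _ hxI _ trivial⟩, hne⟩
    exact ⟨q y, ⟨hy.2, hqrel y hyR⟩, fun h => hy0 (hKJ y hy.1 h)⟩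
end

section
/- Let (A,D) be a pseudo-Cartan inclusion with Cartan envelope (A₁, D₁, α) and faithful conditional expectation E : A₁ → D₁, let J be a regular ideal of A, and set J₁ = {a ∈ A₁ : E(a*a) ∈ (α(J ∩ D))^{⊥⊥_{D₁}}}, where the double annihilator is computed in D₁. Then for every a ∈ A, α(a) ∈ J₁ if and only if a ∈ J; in particular α^{-1}(J₁) = J. -/
section Helpers

variable {A : Type*} [NonUnitalCStarAlgebra A]

theorem eq_zero_of_mul_star_mul {z : A} (h : z * (star z * z) = 0) : z = 0 := by
  have h1 : star (star z * z) * (star z * z) = 0 := by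
    rw [star_mul, star_star, mul_assoc, h, mul_zero]
  exact CStarRing.star_mul_self_eq_zero_iff z |>.1 (CStarRing.star_mul_self_eq_zero_iff _ |>.1 h1)

theorem isClosed_relComm (D : Set A) : IsClosed (RelComm D) := by
  have : RelComm D = ⋂ d ∈ D, {a : A | a * d = d * a} := by
    ext a; simp [RelComm]
  rw [this]
  refine isClosed_biInter fun d _ => isClosed_eq ?_ ?_ <;> fun_prop

theorem isClosed_ann {C : Set A} (hC : IsClosed C) (X : Set A) : IsClosed (Ann C X) := by
  have : Ann C X = C ∩ ⋂ x ∈ X, ({c : A | c * x = 0} ∩ {c : A | x * c = 0}) := by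
    ext a; simp [Ann]
  rw [this]
  refine hC.inter (isClosed_biInter fun d _ => (isClosed_eq ?_ ?_).inter (isClosed_eq ?_ ?_)) <;>
    fun_prop

variable [PartialOrder A] [StarOrderedRing A]

/-- A pseudo-Cartan inclusion has the ideal intersection property. -/
theorem iip_of_pseudoCartan {D : Set A} (hD : IsPseudoCartan D) :
    IdealIntersectionProperty (Set.univ : Set A) D := by
  intro J hJ hne
  obtain ⟨x, ⟨hxJ, hxC⟩, hx0⟩ := hD.iip_A J hJ hne
  have hI : IsClosedIdealOf (RelComm D) (J ∩ RelComm D) := by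
    refine ⟨Set.inter_subset_right, ⟨hJ.zero_mem, ?_⟩, ?_, ?_, ?_, ?_,
      hJ.isClosed.inter (isClosed_relComm D)⟩
    · intro d _; simp
    · rintro x ⟨hx, hx'⟩ y ⟨hy, hy'⟩
      refine ⟨hJ.add_mem x hx y hy, fun d hd => ?_⟩
      rw [add_mul, mul_add, hx' d hd, hy' d hd]
    · rintro c x ⟨hx, hx'⟩
      refine ⟨hJ.smul_mem c x hx, fun d hd => ?_⟩
      rw [smul_mul_assoc, mul_smul_comm, hx' d hd]
    · rintro c hc x ⟨hx, hx'⟩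
      refine ⟨hJ.mul_left c trivial x hx, fun d hd => ?_⟩
      rw [mul_assoc, hx' d hd, ← mul_assoc, hc d hd, mul_assoc]
    · rintro x ⟨hx, hx'⟩ c hc
      refine ⟨hJ.mul_right x hx c trivial, fun d hd => ?_⟩
      rw [mul_assoc, hc d hd, ← mul_assoc, hx' d hd, mul_assoc]
  obtain ⟨y, ⟨⟨hyJ, _⟩, hyD⟩, hy0⟩ := hD.iip_relComm _ hI ⟨x, ⟨hxJ, hxC⟩, hx0⟩
  exact ⟨y, ⟨hyJ, hyD⟩, hy0⟩

/-- If `e` kills `J ∩ D` then `e A (J ∩ D) = 0`. -/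
theorem mul_mul_eq_zero {D J : Set A} (hD : IsPseudoCartan D)
    (hJ : IsClosedIdealOf (Set.univ : Set A) J) {e : A} (he : ∀ k ∈ J ∩ D, e * k = 0)
    (y : A) {k : A} (hk : k ∈ J ∩ D) : e * y * k = 0 := by
  have hcl : IsClosed {y : A | e * y * k = 0} := isClosed_eq (by fun_prop) (by fun_prop)
  have hsub : (↑(Submodule.span ℂ {n : A | IsNormalizer D n}) : Set A) ⊆
      {y : A | e * y * k = 0} := by
    intro y hy
    induction hy using Submodule.span_induction with
    | mem n hn =>
      have hmem : n * (k * star k) * star n ∈ J ∩ D :=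
        ⟨hJ.mul_right _ (hJ.mul_left _ trivial _ (hJ.mul_right _ hk.1 _ trivial)) _ trivial,
          hn.1 _ (hD.inclusion.mul_mem _ hk.2 _ (hD.inclusion.star_mem _ hk.2))⟩
      have h0 := he _ hmem
      refine (CStarRing.mul_star_self_eq_zero_iff (e * n * k)).1 ?_
      calc e * n * k * star (e * n * k) = e * (n * (k * star k) * star n) * star e := by
            simp only [star_mul, mul_assoc]
        _ = 0 := by rw [h0, zero_mul]
    | zero => simp
    | add x y _ _ hx hy =>
      simp only [Set.mem_ofPred_eq] at hx hy ⊢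
      rw [mul_add, add_mul, hx, hy, add_zero]
    | smul c x _ hx =>
      simp only [Set.mem_ofPred_eq] at hx ⊢
      rw [mul_smul_comm, smul_mul_assoc, hx, smul_zero]
  have := hcl.closure_subset_iff.2 hsub
  exact this (hD.regular y)

/-- An element `x` of the ideal `J` which kills `A (J ∩ D)` is zero. -/
theorem eq_zero_of_mem_of_kill {D J : Set A} (hD : IsPseudoCartan D)
    (hJ : IsClosedIdealOf (Set.univ : Set A) J) {x : A} (hx : x ∈ J)
    (hkill : ∀ y : A, ∀ k ∈ J ∩ D, x * y * k = 0) : x = 0 := by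
  by_contra hx0
  have hcl : IsClosed {x : A | ∀ y : A, ∀ k ∈ J ∩ D, x * y * k = 0} := by
    have : {x : A | ∀ y : A, ∀ k ∈ J ∩ D, x * y * k = 0} =
        ⋂ y : A, ⋂ k ∈ J ∩ D, {x : A | x * y * k = 0} := by
      ext a; simp only [Set.mem_ofPred_eq, Set.mem_iInter]
    rw [this]
    refine isClosed_iInter fun y => isClosed_biInter fun k _ => isClosed_eq ?_ ?_ <;> fun_prop
  have hI : IsClosedIdealOf (Set.univ : Set A)
      (J ∩ {x : A | ∀ y : A, ∀ k ∈ J ∩ D, x * y * k = 0}) := by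
    refine ⟨Set.subset_univ _, ⟨hJ.zero_mem, ?_⟩, ?_, ?_, ?_, ?_, hJ.isClosed.inter hcl⟩
    · intro y k _; simp
    · rintro a ⟨ha, ha'⟩ b ⟨hb, hb'⟩
      refine ⟨hJ.add_mem a ha b hb, fun y k hk => ?_⟩
      rw [add_mul, add_mul, ha' y k hk, hb' y k hk, add_zero]
    · rintro c a ⟨ha, ha'⟩
      refine ⟨hJ.smul_mem c a ha, fun y k hk => ?_⟩
      rw [smul_mul_assoc, smul_mul_assoc, ha' y k hk, smul_zero]
    · rintro c hc a ⟨ha, ha'⟩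
      refine ⟨hJ.mul_left c hc a ha, fun y k hk => ?_⟩
      rw [mul_assoc c, mul_assoc c, ha' y k hk, mul_zero]
    · rintro a ⟨ha, ha'⟩ c hc
      refine ⟨hJ.mul_right a ha c hc, fun y k hk => ?_⟩
      rw [mul_assoc a, ha' _ k hk]
  obtain ⟨z, ⟨⟨hzJ, hz⟩, hzD⟩, hz0⟩ := iip_of_pseudoCartan hD _ hI ⟨x, ⟨hx, hkill⟩, hx0⟩
  apply hz0
  apply eq_zero_of_mul_star_mul
  rw [← mul_assoc]
  exact hz (star z) z ⟨hzJ, hzD⟩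

theorem isClosedIdealOf_ann {J : Set A} (hJ : IsClosedIdealOf (Set.univ : Set A) J) :
    IsClosedIdealOf (Set.univ : Set A) (Ann Set.univ J) := by
  refine ⟨Set.subset_univ _, ⟨trivial, by simp⟩, ?_, ?_, ?_, ?_, isClosed_ann isClosed_univ _⟩
  · rintro x ⟨_, hx⟩ y ⟨_, hy⟩
    refine ⟨trivial, fun j hj => ⟨?_, ?_⟩⟩
    · rw [add_mul, (hx j hj).1, (hy j hj).1, add_zero]
    · rw [mul_add, (hx j hj).2, (hy j hj).2, add_zero]
  · rintro c x ⟨_, hx⟩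
    refine ⟨trivial, fun j hj => ⟨?_, ?_⟩⟩
    · rw [smul_mul_assoc, (hx j hj).1, smul_zero]
    · rw [mul_smul_comm, (hx j hj).2, smul_zero]
  · rintro c _ x ⟨_, hx⟩
    refine ⟨trivial, fun j hj => ⟨?_, ?_⟩⟩
    · rw [mul_assoc, (hx j hj).1, mul_zero]
    · rw [← mul_assoc, (hx _ (hJ.mul_right j hj c trivial)).2]
  · rintro x ⟨_, hx⟩ c _
    refine ⟨trivial, fun j hj => ⟨?_, ?_⟩⟩
    · rw [mul_assoc, (hx _ (hJ.mul_left c trivial j hj)).1]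
    · rw [← mul_assoc, (hx j hj).2, zero_mul]

/-- Annihilators in an abelian subalgebra are closed ideals. -/
theorem isClosedIdealOf_ann_comm {C : Set A} (hC : IsInclusion C)
    (hab : ∀ x ∈ C, ∀ y ∈ C, x * y = y * x) {X : Set A} (hX : X ⊆ C) :
    IsClosedIdealOf C (Ann C X) := by
  refine ⟨fun x hx => hx.1, ⟨hC.zero_mem, by simp⟩, ?_, ?_, ?_, ?_, isClosed_ann hC.isClosed _⟩
  · rintro x ⟨hxC, hx⟩ y ⟨hyC, hy⟩
    refine ⟨hC.add_mem _ hxC _ hyC, fun j hj => ⟨?_, ?_⟩⟩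
    · rw [add_mul, (hx j hj).1, (hy j hj).1, add_zero]
    · rw [mul_add, (hx j hj).2, (hy j hj).2, add_zero]
  · rintro c x ⟨hxC, hx⟩
    refine ⟨hC.smul_mem _ _ hxC, fun j hj => ⟨?_, ?_⟩⟩
    · rw [smul_mul_assoc, (hx j hj).1, smul_zero]
    · rw [mul_smul_comm, (hx j hj).2, smul_zero]
  · rintro c hc x ⟨hxC, hx⟩
    refine ⟨hC.mul_mem _ hc _ hxC, fun j hj => ⟨?_, ?_⟩⟩
    · rw [mul_assoc, (hx j hj).1, mul_zero]
    · rw [hab c hc x hxC, ← mul_assoc, (hx j hj).2, zero_mul]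
  · rintro x ⟨hxC, hx⟩ c hc
    refine ⟨hC.mul_mem _ hxC _ hc, fun j hj => ⟨?_, ?_⟩⟩
    · rw [hab x hxC c hc, mul_assoc, (hx j hj).1, mul_zero]
    · rw [← mul_assoc, (hx j hj).2, zero_mul]

/-- In an abelian subalgebra, `x y = 0` implies `x* y = 0`. -/
theorem star_mul_eq_zero_of_comm {C : Set A} (hC : IsInclusion C)
    (hab : ∀ x ∈ C, ∀ y ∈ C, x * y = y * x) {x y : A} (hx : x ∈ C) (h : x * y = 0) :
    star x * y = 0 := by
  refine (CStarRing.star_mul_self_eq_zero_iff _).1 ?_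
  calc star (star x * y) * (star x * y) = star y * ((x * star x) * y) := by
        simp only [star_mul, star_star, mul_assoc]
    _ = star y * (star x * (x * y)) := by
        rw [hab x hx _ (hC.star_mem x hx), mul_assoc]
    _ = 0 := by rw [h, mul_zero, mul_zero]

end Helpers

/-- Let `(A,D)` be a pseudo-Cartan inclusion with Cartan envelope
`(A₁, D₁, α)` and faithful conditional expectation `E : A₁ → D₁`, let `J` be a regular
ideal of `A`, and set `J₁ = {a ∈ A₁ : E(a*a) ∈ (α(J ∩ D))^{⊥⊥_{D₁}}}`.  Then for every
`a ∈ A`, `α a ∈ J₁ ↔ a ∈ J`; in particular `α⁻¹(J₁) = J`. -/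
theorem mem_J1_iff_mem_J
    {A : Type*} [NonUnitalCStarAlgebra A] [PartialOrder A] [StarOrderedRing A]
    {A₁ : Type*} [NonUnitalCStarAlgebra A₁] [PartialOrder A₁] [StarOrderedRing A₁]
    (D : Set A) (D₁ : Set A₁) (α : A →⋆ₙₐ[ℂ] A₁) (E : A₁ → A₁)
    (hD : IsPseudoCartan D) (henv : IsCartanEnvelope D D₁ α E)
    (J : Set A) (hJ : IsRegularIdealOf (Set.univ : Set A) J) :
    (∀ a : A,
      α a ∈ {a₁ : A₁ | E (star a₁ * a₁) ∈ Ann D₁ (Ann D₁ (⇑α '' (J ∩ D)))} ↔ a ∈ J) ∧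
    ⇑α ⁻¹' {a₁ : A₁ | E (star a₁ * a₁) ∈ Ann D₁ (Ann D₁ (⇑α '' (J ∩ D)))} = J := by
  have key : ∀ a : A,
      α a ∈ {a₁ : A₁ | E (star a₁ * a₁) ∈ Ann D₁ (Ann D₁ (⇑α '' (J ∩ D)))} ↔ a ∈ J := by
    intro a
    obtain ⟨hJi, hJr⟩ := hJ
    have hD₁ : IsInclusion D₁ := henv.cartan.regularInclusion.1
    have hab := henv.cartan.abelian
    have hE := henv.cartan.condExp
    simp only [Set.mem_ofPred_eq]
    set g : A₁ := E (star (α a) * α a) with hg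
    have hgD : g ∈ D₁ := hE.mem _
    have hbim : ∀ e ∈ D, star (α e) * g * α e = E (star (α (a * e)) * α (a * e)) := by
      intro e he
      rw [hg, ← hE.bimodule _ (hD₁.star_mem _ (henv.maps e he)) _ _ (henv.maps e he)]
      simp only [map_mul, star_mul, mul_assoc]
    constructor
    · intro hmem
      have hL := isClosedIdealOf_ann hJi
      -- `a` kills `L ∩ D`
      have haM : ∀ e ∈ Ann Set.univ J ∩ D, a * e = 0 := by
        rintro e ⟨heL, heD⟩
        have hαe : α e ∈ Ann D₁ (⇑α '' (J ∩ D)) := by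
          refine ⟨henv.maps e heD, ?_⟩
          rintro _ ⟨k, hk, rfl⟩
          rw [← map_mul, ← map_mul, (heL.2 k hk.1).1, (heL.2 k hk.1).2, map_zero]
          exact ⟨rfl, rfl⟩
        have h0 : g * α e = 0 := (hmem.2 _ hαe).1
        have h1 := hbim e heD
        rw [mul_assoc, h0, mul_zero] at h1
        apply henv.injective
        rw [map_zero]
        exact hE.faithful _ h1.symm
      have haL : ∀ l ∈ Ann Set.univ J, a * l = 0 := by
        intro l hl
        refine eq_zero_of_mem_of_kill hD hL (hL.mul_left a trivial l hl) fun y k hk => ?_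
        rw [mul_assoc a]
        exact mul_mul_eq_zero hD hL haM _ hk
      rw [← hJr]
      refine ⟨trivial, fun l hl => ⟨haL l hl, ?_⟩⟩
      apply eq_zero_of_mul_star_mul
      rw [mul_assoc l a, haL _ (hL.mul_left _ trivial _ (hL.mul_right _ hl _ trivial)), mul_zero]
    · intro haJ
      refine ⟨hgD, fun d hd => ?_⟩
      have hgd : g * d = 0 := by
        by_contra hne
        have hhD : g * d ∈ D₁ := hD₁.mul_mem _ hgD _ hd.1
        have hI : IsClosedIdealOf D₁ (Ann D₁ (Ann D₁ {g * d})) :=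
          isClosedIdealOf_ann_comm hD₁ hab fun x hx => hx.1
        have hmemI : g * d ∈ Ann D₁ (Ann D₁ {g * d}) :=
          ⟨hhD, fun x hx => ⟨(hx.2 _ rfl).2, (hx.2 _ rfl).1⟩⟩
        obtain ⟨_, ⟨hx, ⟨e, heD, rfl⟩⟩, hx0⟩ := henv.iip _ hI ⟨_, hmemI, hne⟩
        have heK : ∀ k ∈ J ∩ D, e * k = 0 := by
          intro k hk
          have hkD := henv.maps k hk.2
          have hdk := hd.2 _ ⟨k, hk, rfl⟩
          have hαk : α k ∈ Ann D₁ {g * d} := by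
            have h1 : g * d * α k = 0 := by rw [mul_assoc, hdk.1, mul_zero]
            refine ⟨hkD, ?_⟩
            rintro _ rfl
            exact ⟨by rw [hab _ hkD _ hhD, h1], h1⟩
          apply henv.injective
          rw [map_mul, map_zero]
          exact (hx.2 _ hαk).1
        have hae : a * e = 0 := by
          refine eq_zero_of_mem_of_kill hD hJi (hJi.mul_right a haJ e trivial) fun y k hk => ?_
          rw [mul_assoc a, mul_assoc a, mul_mul_eq_zero hD hJi heK y hk, mul_zero]
        have heD₁ := henv.maps e heD
        have hsD₁ := hD₁.star_mem _ heD₁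
        have h1 : star (α e) * g * α e = 0 := by
          rw [hbim e heD, hae, map_zero, mul_zero]
          simpa using hE.map_smul 0 0
        have h2 : g * α e = 0 := by
          refine (CStarRing.star_mul_self_eq_zero_iff _).1 ?_
          calc star (g * α e) * (g * α e) = star (α e) * star g * (g * α e) := by rw [star_mul]
            _ = star g * (star (α e) * g * α e) := by
                rw [hab _ hsD₁ _ (hD₁.star_mem _ hgD)]; simp only [mul_assoc]
            _ = 0 := by rw [h1, mul_zero]
        have h3 : α e * (g * d) = 0 := by
          rw [← mul_assoc, hab _ heD₁ _ hgD, h2, zero_mul]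
        have h4 : star (α e) * (g * d) = 0 := star_mul_eq_zero_of_comm hD₁ hab heD₁ h3
        have h5 : star (α e) ∈ Ann D₁ {g * d} := by
          refine ⟨hsD₁, ?_⟩
          rintro _ rfl
          exact ⟨h4, by rw [hab _ hhD _ hsD₁, h4]⟩
        exact hx0 ((CStarRing.mul_star_self_eq_zero_iff _).1 (hx.2 _ h5).1)
      exact ⟨hgd, by rw [hab _ hd.1 _ hgD, hgd]⟩
  exact ⟨key, Set.ext key⟩
end
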